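/- arXiv:1303.3236 — 4 statements merged into one kernel-verified Lean document; each statement's English description precedes it below -/
import Mathlib

section
/- Let B_n denote the number of quarter-plane walks of length n with steps from ℬ = {(−1,1),(0,1),(1,0),(1,−1)}. Then there exist a real constant κ > 0 and a constant C > 0 such that for all n ≥ 0, |B_n − κ·4^n| ≤ C·(1+2√2)^n. -/
/-- The number of quarter-plane walks of length `n` with steps from `S`:
sequences of `n` steps, each in `S`, all of whose partial sums have both
coordinates nonnegative. -/
noncomputable def quarterPlaneWalks (S : Finset (ℤ × ℤ)) (n : ℕ) : ℕ :=
  Nat.card {f : Fin n → ℤ × ℤ //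
    (∀ k, f k ∈ S) ∧
    ∀ k : Fin n, 0 ≤ ∑ j ∈ Finset.Iic k, (f j).1 ∧ 0 ≤ ∑ j ∈ Finset.Iic k, (f j).2}

/-- The step set of model B. -/
abbrev stepsB : Finset (ℤ × ℤ) := {(-1,1),(0,1),(1,0),(1,-1)}

/-- The quarter-plane condition. -/
def QP (n : ℕ) (f : Fin n → ℤ × ℤ) : Prop :=
  ∀ k : Fin n, 0 ≤ ∑ j ∈ Finset.Iic k, (f j).1 ∧ 0 ≤ ∑ j ∈ Finset.Iic k, (f j).2

/-- The nonnegative quadrant. -/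
def Quad (p : ℤ × ℤ) : Prop := 0 ≤ p.1 ∧ 0 ≤ p.2

open Classical in
/-- Sum of `g` over the endpoints of all quarter-plane walks of length `n`. -/
noncomputable def wsum (n : ℕ) (g : ℤ × ℤ → ℝ) : ℝ :=
  ∑ f ∈ Fintype.piFinset (fun _ : Fin n => stepsB), if QP n f then g (∑ j, f j) else 0

open Classical in
/-- One-step operator. -/
noncomputable def stepOp (g : ℤ × ℤ → ℝ) (p : ℤ × ℤ) : ℝ :=
  ∑ s ∈ stepsB, if Quad (p + s) then g (p + s) else 0

lemma sum_Iic_snoc (n : ℕ) (f : Fin n → ℤ × ℤ) (s : ℤ × ℤ) (h : ℤ × ℤ → ℤ) (k : Fin n) :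
    ∑ j ∈ Finset.Iic k.castSucc, h ((Fin.snoc f s : Fin (n+1) → ℤ × ℤ) j)
      = ∑ j ∈ Finset.Iic k, h (f j) := by
  rw [← Fin.map_castSuccEmb_Iic, Finset.sum_map]
  simp

lemma QP_snoc (n : ℕ) (f : Fin n → ℤ × ℤ) (s : ℤ × ℤ) :
    QP (n+1) (Fin.snoc f s : Fin (n+1) → ℤ × ℤ) ↔ QP n f ∧ Quad ((∑ j, f j) + s) := by
  unfold QP Quad
  rw [Fin.forall_fin_succ']
  have h1 := sum_Iic_snoc n f s Prod.fst
  have h2 := sum_Iic_snoc n f s Prod.snd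
  simp only [h1, h2]
  have : Finset.Iic (Fin.last n) = Finset.univ := by
    ext x; simp [Fin.le_last]
  rw [this, Fin.sum_univ_castSucc, Fin.sum_univ_castSucc]
  simp [Prod.fst_sum, Prod.snd_sum]

lemma wsum_succ (n : ℕ) (g : ℤ × ℤ → ℝ) : wsum (n+1) g = wsum n (stepOp g) := by
  classical
  unfold wsum stepOp
  have : ∀ f : Fin n → ℤ × ℤ, (if QP n f then
      (∑ s ∈ stepsB, if Quad ((∑ j, f j) + s) then g ((∑ j, f j) + s) else 0) else 0)
      = ∑ s ∈ stepsB, if QP (n+1) (Fin.snoc f s : Fin (n+1) → ℤ × ℤ) then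
          g (∑ j, (Fin.snoc f s : Fin (n+1) → ℤ × ℤ) j) else 0 := by
    intro f
    by_cases h : QP n f
    · simp only [QP_snoc, h, if_true, true_and, Fin.sum_univ_castSucc, Fin.snoc_castSucc,
        Fin.snoc_last]
    · simp [QP_snoc, h]
  simp only [this]
  rw [← Finset.sum_product']
  symm
  refine Finset.sum_bij' (fun x _ => (Fin.snoc x.1 x.2 : Fin (n+1) → ℤ × ℤ))
    (fun f _ => (Fin.init f, f (Fin.last n))) ?_ ?_ ?_ ?_ ?_
  · rintro ⟨f, s⟩ h
    rw [Finset.mem_product, Fintype.mem_piFinset] at h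
    rw [Fintype.mem_piFinset, Fin.forall_fin_succ']
    simpa only [Fin.snoc_castSucc, Fin.snoc_last] using h
  · intro f h
    rw [Fintype.mem_piFinset] at h
    rw [Finset.mem_product, Fintype.mem_piFinset]
    exact ⟨fun k => h _, h _⟩
  · rintro ⟨f, s⟩ _
    simp
  · intro f _
    simp
  · intro x _
    rfl

lemma quad_of_QP (n : ℕ) (f : Fin n → ℤ × ℤ) (h : QP n f) : Quad (∑ j, f j) := by
  cases n with
  | zero => simp [Quad]
  | succ n =>
    have := h (Fin.last n)
    have e : Finset.Iic (Fin.last n) = Finset.univ := by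
      ext x; simp [Fin.le_last]
    rw [e] at this
    simpa [Quad, Prod.fst_sum, Prod.snd_sum] using this

lemma wsum_mono (n : ℕ) (g h : ℤ × ℤ → ℝ) (H : ∀ p, Quad p → g p ≤ h p) :
    wsum n g ≤ wsum n h := by
  classical
  unfold wsum
  refine Finset.sum_le_sum fun f _ => ?_
  split_ifs with hf
  · exact H _ (quad_of_QP n f hf)
  · exact le_rfl

lemma wsum_lin (n : ℕ) (a b : ℝ) (g h : ℤ × ℤ → ℝ) :
    wsum n (fun p => a * g p + b * h p) = a * wsum n g + b * wsum n h := by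
  classical
  unfold wsum
  rw [Finset.mul_sum, Finset.mul_sum, ← Finset.sum_add_distrib]
  refine Finset.sum_congr rfl fun f _ => ?_
  split_ifs <;> simp

lemma wsum_smul (n : ℕ) (a : ℝ) (g : ℤ × ℤ → ℝ) :
    wsum n (fun p => a * g p) = a * wsum n g := by
  simpa using wsum_lin n a 0 g g

lemma wsum_zero (g : ℤ × ℤ → ℝ) : wsum 0 g = g 0 := by
  classical
  simp [wsum, QP]

lemma walks_eq (n : ℕ) : (quarterPlaneWalks stepsB n : ℝ) = wsum n (fun _ => 1) := by
  classical
  unfold wsum quarterPlaneWalks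
  rw [Finset.sum_boole]
  congr 1
  refine Nat.subtype_card _ fun f => ?_
  rw [Finset.mem_filter, Fintype.mem_piFinset]
  rfl

open Classical in
lemma stepOp_eq (g : ℤ × ℤ → ℝ) (a b : ℤ) : stepOp g (a, b) =
    (if Quad (a - 1, b + 1) then g (a - 1, b + 1) else 0)
    + (if Quad (a, b + 1) then g (a, b + 1) else 0)
    + (if Quad (a + 1, b) then g (a + 1, b) else 0)
    + (if Quad (a + 1, b - 1) then g (a + 1, b - 1) else 0) := by
  unfold stepOp stepsB
  rw [Finset.sum_insert (by decide), Finset.sum_insert (by decide),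
    Finset.sum_insert (by decide), Finset.sum_singleton]
  simp only [Prod.mk_add_mk, add_zero, ← sub_eq_add_neg]
  ring

/-- Decay weight. -/
noncomputable def wt (p : ℤ × ℤ) : ℝ := (1 / Real.sqrt 2) ^ p.1 + (1 / Real.sqrt 2) ^ p.2

/-- Survival bound. -/
noncomputable def surv (p : ℤ × ℤ) : ℝ := 1 - (1 / 2 : ℝ) ^ (p.1 + 1) - (1 / 2 : ℝ) ^ (p.2 + 1)

lemma wt_nonneg (p : ℤ × ℤ) : 0 ≤ wt p := by unfold wt; positivity

lemma stepOp_wt (p : ℤ × ℤ) : stepOp wt p ≤ (1 + 2 * Real.sqrt 2) * wt p := by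
  classical
  obtain ⟨a, b⟩ := p
  rw [stepOp_eq]
  have hi : ∀ q, (if Quad q then wt q else 0) ≤ wt q := by
    intro q; split_ifs; exacts [le_rfl, wt_nonneg q]
  refine (add_le_add (add_le_add (add_le_add (hi _) (hi _)) (hi _)) (hi _)).trans (le_of_eq ?_)
  have h2 : Real.sqrt 2 ^ 2 = 2 := Real.sq_sqrt (by norm_num)
  have h0 : Real.sqrt 2 ≠ 0 := by positivity
  have hr : (1 / Real.sqrt 2) ≠ 0 := by positivity
  have hh : 1 / Real.sqrt 2 = Real.sqrt 2 / 2 := by field_simp; linarith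
  simp only [wt, zpow_add_one₀ hr, zpow_sub_one₀ hr]
  simp only [one_div, inv_inv] at hh ⊢
  generalize (Real.sqrt 2)⁻¹ ^ a = x
  generalize (Real.sqrt 2)⁻¹ ^ b = y
  rw [hh]
  ring

lemma stepOp_surv (p : ℤ × ℤ) : 4 * surv p ≤ stepOp surv p := by
  classical
  obtain ⟨a, b⟩ := p
  rw [stepOp_eq]
  have hi : ∀ q, surv q ≤ (if Quad q then surv q else 0) := by
    intro q
    split_ifs with h
    · exact le_rfl
    · unfold Quad at h
      unfold surv
      have h1 : (0:ℝ) < (1 / 2 : ℝ) ^ (q.1 + 1) := by positivity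
      have h2 : (0:ℝ) < (1 / 2 : ℝ) ^ (q.2 + 1) := by positivity
      have key : ∀ m : ℤ, m < 0 → 1 ≤ (1 / 2 : ℝ) ^ (m + 1) := fun m hm =>
        one_le_zpow_of_nonpos₀ (by norm_num) (by norm_num) (by omega)
      rw [not_and_or, not_le, not_le] at h
      rcases h with h | h
      · linarith [key _ h]
      · linarith [key _ h]
  refine (le_of_eq ?_).trans
    (add_le_add (add_le_add (add_le_add (hi _) (hi _)) (hi _)) (hi _))
  have hr : (1 / 2 : ℝ) ≠ 0 := by norm_num
  simp only [surv, zpow_add_one₀ hr, zpow_sub_one₀ hr]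
  ring

lemma stepOp_one_le (p : ℤ × ℤ) : stepOp (fun _ => 1) p ≤ 4 * 1 := by
  classical
  obtain ⟨a, b⟩ := p
  rw [stepOp_eq]
  split_ifs <;> norm_num

lemma le_stepOp_one (p : ℤ × ℤ) (hp : Quad p) :
    4 * 1 + (-1) * wt p ≤ stepOp (fun _ => 1) p := by
  classical
  obtain ⟨a, b⟩ := p
  obtain ⟨ha, hb⟩ := hp
  simp only at ha hb
  rw [stepOp_eq]
  have e2 : Quad (a, b + 1) := ⟨ha, by simp only; omega⟩
  have e3 : Quad (a + 1, b) := ⟨by simp only; omega, hb⟩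
  have key : ∀ m : ℤ, (0:ℝ) < (1 / Real.sqrt 2) ^ m := fun m => by positivity
  have e1 : 1 - (1 / Real.sqrt 2) ^ a ≤ if Quad (a - 1, b + 1) then (1:ℝ) else 0 := by
    split_ifs with h
    · linarith [key a]
    · have : a = 0 := by
        by_contra h'
        exact h ⟨by simp only; omega, by simp only; omega⟩
      simp [this]
  have e4 : 1 - (1 / Real.sqrt 2) ^ b ≤ if Quad (a + 1, b - 1) then (1:ℝ) else 0 := by
    split_ifs with h
    · linarith [key b]
    · have : b = 0 := by
        by_contra h'
        exact h ⟨by simp only; omega, by simp only; omega⟩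
      simp [this]
  rw [if_pos e2, if_pos e3]
  simp only [wt]
  linarith

lemma wsum_wt (n : ℕ) : wsum n wt ≤ 2 * (1 + 2 * Real.sqrt 2) ^ n := by
  induction n with
  | zero => rw [wsum_zero]; norm_num [wt]
  | succ n ih =>
    rw [wsum_succ]
    refine (wsum_mono n _ _ fun p _ => stepOp_wt p).trans ?_
    rw [wsum_smul]
    have : 0 ≤ 1 + 2 * Real.sqrt 2 := by positivity
    calc _ ≤ (1 + 2 * Real.sqrt 2) * (2 * (1 + 2 * Real.sqrt 2) ^ n) := by gcongr
      _ = _ := by ring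

lemma wsum_surv (n : ℕ) : (1 / 8) * 4 ^ (n + 1) ≤ wsum (n + 1) surv := by
  classical
  induction n with
  | zero =>
    rw [wsum_succ, wsum_zero, show (0 : ℤ × ℤ) = (0, 0) from rfl, stepOp_eq]
    norm_num [Quad, surv]
  | succ n ih =>
    rw [wsum_succ]
    refine le_trans ?_ (wsum_mono (n + 1) _ _ fun p _ => stepOp_surv p)
    rw [wsum_smul, pow_succ]
    linarith

lemma surv_le_one (p : ℤ × ℤ) : surv p ≤ 1 := by
  unfold surv
  have h1 : (0:ℝ) < (1 / 2 : ℝ) ^ (p.1 + 1) := by positivity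
  have h2 : (0:ℝ) < (1 / 2 : ℝ) ^ (p.2 + 1) := by positivity
  linarith

/-- Abstract limiting argument. -/
lemma limit_argument (B : ℕ → ℝ) (r : ℝ) (hr0 : 0 < r) (hr : r < 4)
    (h1 : ∀ n, B (n + 1) ≤ 4 * B n) (h2 : ∀ n, 4 * B n - 2 * r ^ n ≤ B (n + 1))
    (h3 : ∀ n, (1 / 8) * 4 ^ (n + 1) ≤ B (n + 1)) :
    ∃ κ C : ℝ, 0 < κ ∧ 0 < C ∧ ∀ n : ℕ, |B n - κ * 4 ^ n| ≤ C * r ^ n := by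
  set b : ℕ → ℝ := fun n => B n / 4 ^ n with hb
  set C : ℝ := 2 / (4 - r) with hC
  have hCpos : 0 < C := div_pos (by norm_num) (by linarith)
  have hCr : C * (4 - r) = 2 := by rw [hC]; field_simp [show (4 - r) ≠ 0 by linarith]
  have hanti : Antitone b := by
    refine antitone_nat_of_succ_le fun n => ?_
    simp only [hb]
    rw [div_le_div_iff₀ (by positivity) (by positivity), pow_succ]
    nlinarith [h1 n, pow_pos (show (0:ℝ) < 4 by norm_num) n]
  have hlow : ∀ n, 1 / 8 ≤ b (n + 1) := by
    intro n
    simp only [hb]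
    rw [le_div_iff₀ (by positivity)]
    exact h3 n
  have hlow' : ∀ n, 1 / 8 ≤ b n := fun n => (hlow n).trans (hanti (Nat.le_succ n))
  have hbdd : BddBelow (Set.range b) := ⟨1 / 8, by rintro _ ⟨n, rfl⟩; exact hlow' n⟩
  have hlim := tendsto_atTop_ciInf hanti hbdd
  set κ := ⨅ n, b n with hκ
  have hκ8 : 1 / 8 ≤ κ := le_ciInf hlow'
  have hmono : Monotone fun n => b n - C * (r / 4) ^ n := by
    refine monotone_nat_of_le_succ fun n => ?_
    have e : b (n + 1) - C * (r / 4) ^ (n + 1) - (b n - C * (r / 4) ^ n)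
        = (B (n + 1) - 4 * B n + C * (4 - r) * r ^ n) / 4 ^ (n + 1) := by
      simp only [hb, div_pow, pow_succ]
      field_simp
      ring
    have : 0 ≤ (B (n + 1) - 4 * B n + C * (4 - r) * r ^ n) / 4 ^ (n + 1) := by
      apply div_nonneg _ (by positivity)
      rw [hCr]
      linarith [h2 n]
    linarith
  have hlim2 : Filter.Tendsto (fun n => b n - C * (r / 4) ^ n) Filter.atTop (nhds κ) := by
    have := (tendsto_pow_atTop_nhds_zero_of_lt_one (r := r / 4) (by positivity)
      (by linarith)).const_mul C
    simpa using hlim.sub this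
  refine ⟨κ, C, by linarith, hCpos, fun n => ?_⟩
  have u1 : κ ≤ b n := ciInf_le hbdd n
  have u2 : b n - C * (r / 4) ^ n ≤ κ := hmono.ge_of_tendsto hlim2 n
  have p4 : (0:ℝ) < 4 ^ n := by positivity
  have eB : B n = b n * 4 ^ n := by simp only [hb]; field_simp
  have er : r ^ n = (r / 4) ^ n * 4 ^ n := by rw [← mul_pow]; congr 1; ring
  rw [eB, er, ← sub_mul, abs_of_nonneg (mul_nonneg (by linarith) p4.le), ← mul_assoc]
  exact mul_le_mul_of_nonneg_right (by linarith) p4.le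

theorem modelB_asymptotics :
    ∃ κ C : ℝ, 0 < κ ∧ 0 < C ∧ ∀ n : ℕ,
      |(quarterPlaneWalks ({(-1,1),(0,1),(1,0),(1,-1)} : Finset (ℤ × ℤ)) n : ℝ) - κ * 4 ^ n| ≤
        C * (1 + 2 * Real.sqrt 2) ^ n := by
  have hs : Real.sqrt 2 < 3 / 2 := by
    rw [Real.sqrt_lt' (by norm_num)]; norm_num
  refine limit_argument (fun n => (quarterPlaneWalks stepsB n : ℝ)) _ (by positivity)
    (by linarith) ?_ ?_ ?_
  · intro n
    simp only [walks_eq]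
    rw [wsum_succ, ← wsum_smul]
    exact wsum_mono n _ _ fun p _ => stepOp_one_le p
  · intro n
    simp only [walks_eq]
    rw [wsum_succ]
    have := wsum_mono n _ _ le_stepOp_one
    rw [wsum_lin] at this
    linarith [wsum_wt n]
  · intro n
    simp only [walks_eq]
    exact (wsum_surv n).trans (wsum_mono _ _ _ fun p _ => surv_le_one p)
end

section
/- Let D_n denote the number of quarter-plane walks of length n with steps from 𝒟 = {(−1,1),(0,1),(1,−1)}. Then there exists a real constant κ with 0 ≤ κ ≤ √(3/π) such that the sequence D_n·√n / 3^n converges to κ as n → ∞. -/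
def qS : Finset (ℤ × ℤ) := {(-1,1),(0,1),(1,-1)}

def qP (n : ℕ) (a b : ℤ) (f : Fin n → ℤ × ℤ) : Prop :=
  0 ≤ a ∧ 0 ≤ b ∧ (∀ k, f k ∈ qS) ∧
    ∀ k : Fin n, 0 ≤ a + ∑ j ∈ Finset.Iic k, (f j).1 ∧ 0 ≤ b + ∑ j ∈ Finset.Iic k, (f j).2

def qM : ℕ → ℕ → ℝ
  | _, 0 => 0
  | 0, _+1 => 1
  | n+1, x+1 => qM n x + qM n (x+1) + qM n (x+2)

def qW : ℕ → ℕ → ℕ → ℕ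
  | _, 0, _ => 0
  | _, _+1, 0 => 0
  | 0, _+1, _+1 => 1
  | n+1, x+1, y+1 => qW n x (y+2) + qW n (x+1) (y+2) + qW n (x+2) y

def qA : ℕ → (ℕ → ℝ) → ℕ → ℕ → ℝ
  | _, _, 0, _ => 0
  | 0, g, x+1, 0 => g (x+1)
  | 0, _, _+1, _+1 => 0
  | _+1, _, _+1, 0 => 0
  | k+1, g, x+1, y+1 => qA k g x (y+2) + qA k g (x+1) (y+2) + qA k g (x+2) y

lemma sum_Iic_cons_zero (n : ℕ) (g : Fin (n+1) → ℤ) :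
    ∑ j ∈ Finset.Iic (0 : Fin (n+1)), g j = g 0 := by
  have : Finset.Iic (0 : Fin (n+1)) = {0} := by
    ext j; simp
  rw [this]; simp

lemma sum_Iic_cons_succ (n : ℕ) (g : Fin (n+1) → ℤ) (k : Fin n) :
    ∑ j ∈ Finset.Iic k.succ, g j = g 0 + ∑ j ∈ Finset.Iic k, g j.succ := by
  have h1 : Finset.Iic k.succ = Finset.univ.filter (fun j => j ≤ k.succ) := by ext; simp
  have h2 : Finset.Iic k = Finset.univ.filter (fun j => j ≤ k) := by ext; simp
  rw [h1, h2, Finset.sum_filter, Finset.sum_filter, Fin.sum_univ_succ]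
  simp

lemma qP_cons (n : ℕ) (a b : ℤ) (s : ℤ × ℤ) (f : Fin n → ℤ × ℤ) :
    qP (n+1) a b (Fin.cons s f) ↔
      0 ≤ a ∧ 0 ≤ b ∧ s ∈ qS ∧ qP n (a+s.1) (b+s.2) f := by
  unfold qP
  rw [Fin.forall_fin_succ, Fin.forall_fin_succ]
  simp only [sum_Iic_cons_zero, sum_Iic_cons_succ, Fin.cons_zero, Fin.cons_succ, add_assoc]
  tauto

lemma qP_finite (n : ℕ) (a b : ℤ) : {f | qP n a b f}.Finite := by
  apply Set.Finite.subset (Fintype.piFinset (fun _ : Fin n => qS)).finite_toSet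
  intro f hf
  simp only [Finset.mem_coe, Fintype.mem_piFinset]
  exact hf.2.2.1

def qcons (n : ℕ) (s : ℤ × ℤ) (f : Fin n → ℤ × ℤ) : Fin (n+1) → ℤ × ℤ := Fin.cons s f

lemma qcons_inj (n : ℕ) (s t : ℤ × ℤ) (f g : Fin n → ℤ × ℤ) :
    qcons n s f = qcons n t g ↔ s = t ∧ f = g := by
  unfold qcons
  exact Fin.cons_inj

lemma qP_decomp (n : ℕ) (a b : ℤ) (ha : 0 ≤ a) (hb : 0 ≤ b) :
    {f | qP (n+1) a b f} =
      ((qcons n (-1,1)) '' {f | qP n (a-1) (b+1) f} ∪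
       (qcons n (0,1)) '' {f | qP n a (b+1) f}) ∪
       (qcons n (1,-1)) '' {f | qP n (a+1) (b-1) f} := by
  ext f
  obtain ⟨s, f, rfl⟩ : ∃ s g, f = qcons n s g := ⟨f 0, Fin.tail f, (Fin.cons_self_tail f).symm⟩
  simp only [Set.mem_ofPred_eq, Set.mem_union, Set.mem_image, qcons_inj]
  rw [show qP (n+1) a b (qcons n s f) ↔ _ from qP_cons n a b s f]
  simp only [qS, Finset.mem_insert, Finset.mem_singleton]
  constructor
  · rintro ⟨-, -, (rfl | rfl | rfl), h⟩
    · exact Or.inl (Or.inl ⟨f, by simpa [sub_eq_add_neg] using h, rfl, rfl⟩)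
    · exact Or.inl (Or.inr ⟨f, by simpa [sub_eq_add_neg] using h, rfl, rfl⟩)
    · exact Or.inr ⟨f, by simpa [sub_eq_add_neg] using h, rfl, rfl⟩
  · rintro ((⟨g, h, rfl, rfl⟩ | ⟨g, h, rfl, rfl⟩) | ⟨g, h, rfl, rfl⟩)
    · exact ⟨ha, hb, by simp, by simpa [sub_eq_add_neg] using h⟩
    · exact ⟨ha, hb, by simp, by simpa [sub_eq_add_neg] using h⟩
    · exact ⟨ha, hb, by simp, by simpa [sub_eq_add_neg] using h⟩

lemma disj_cons (n : ℕ) (s t : ℤ × ℤ) (h : s ≠ t) (A B : Set (Fin n → ℤ × ℤ)) :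
    Disjoint ((qcons n s) '' A)
      ((qcons n t) '' B) := by
  rw [Set.disjoint_left]
  rintro _ ⟨f, -, rfl⟩ ⟨g, -, hg⟩
  exact h ((qcons_inj _ _ _ _ _).1 hg).1.symm

lemma qP_card (n : ℕ) (x y : ℕ) :
    {f | qP n ((x:ℤ)-1) ((y:ℤ)-1) f}.ncard = qW n x y := by
  induction n generalizing x y with
  | zero =>
    rcases x with _ | x
    · simp [qP, qW]
    rcases y with _ | y
    · simp [qP, qW]
    · simp [qP, qW]
  | succ n ih =>
    rcases x with _ | x
    · simp [qP, qW]
    rcases y with _ | y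
    · simp [qP, qW]
    rw [qP_decomp n _ _ (by push_cast; linarith [Int.natCast_nonneg x])
      (by push_cast; linarith [Int.natCast_nonneg y])]
    have hinj : ∀ s : ℤ × ℤ, Function.Injective
        (qcons n s) :=
      fun s f g h => ((qcons_inj _ _ _ _ _).1 h).2
    have hf : ∀ (s : ℤ × ℤ) (a b : ℤ), (qcons n s '' {f | qP n a b f}).Finite :=
      fun s a b => (qP_finite n a b).image _
    rw [Set.ncard_union_eq ?_ ((hf _ _ _).union (hf _ _ _)) (hf _ _ _),
      Set.ncard_union_eq ?_ (hf _ _ _) (hf _ _ _), Set.ncard_image_of_injective _ (hinj _),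
      Set.ncard_image_of_injective _ (hinj _), Set.ncard_image_of_injective _ (hinj _), qW,
      ← ih, ← ih, ← ih]
    · congr 3 <;> (ext f; push_cast; ring_nf)
    · exact disj_cons _ _ _ (by decide) _ _
    · rw [Set.disjoint_union_left]
      exact ⟨disj_cons _ _ _ (by decide) _ _, disj_cons _ _ _ (by decide) _ _⟩

lemma qM_zero (n : ℕ) : qM n 0 = 0 := by cases n <;> simp [qM]

lemma qM_nonneg (n x : ℕ) : 0 ≤ qM n x := by
  induction n generalizing x with
  | zero => cases x <;> simp [qM]
  | succ n ih =>
    cases x with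
    | zero => simp [qM]
    | succ x => rw [qM]; have := ih x; have := ih (x+1); have := ih (x+2); linarith

lemma qM_le (n x : ℕ) : qM n x ≤ 3^n * x := by
  induction n generalizing x with
  | zero => cases x <;> simp [qM]
  | succ n ih =>
    cases x with
    | zero => simp [qM]
    | succ x =>
      rw [qM]; have h1 := ih x; have h2 := ih (x+1); have h3 := ih (x+2)
      push_cast at *
      rw [pow_succ]
      linarith

lemma qA_x_zero (k : ℕ) (g : ℕ → ℝ) (y : ℕ) : qA k g 0 y = 0 := by cases k <;> simp [qA]

lemma qW_x_zero (k : ℕ) (y : ℕ) : qW k 0 y = 0 := by cases k <;> simp [qW]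
lemma qW_y_zero (k : ℕ) (x : ℕ) : qW k x 0 = 0 := by cases k <;> cases x <;> simp [qW]

lemma qM_decomp (n x y : ℕ) :
    qM n x = qW n x y + ∑ k ∈ Finset.range (n+1), qA k (qM (n-k)) x y := by
  induction n generalizing x y with
  | zero => rcases x with _ | x <;> rcases y with _ | y <;> simp [qM, qW, qA]
  | succ n ih =>
    rcases x with _ | x
    · simp [qM_zero, qW_x_zero, qA_x_zero]
    rw [Finset.sum_range_succ']
    rcases y with _ | y
    · simp [qA, qW_y_zero]
    simp only [qA, qW, Nat.add_sub_add_right, Finset.sum_add_distrib]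
    rw [qM, ih x (y+2), ih (x+1) (y+2), ih (x+2) y]
    push_cast
    ring

lemma qA_smul (k : ℕ) (c : ℝ) (g : ℕ → ℝ) (x y : ℕ) :
    c * qA k g x y = qA k (fun z => c * g z) x y := by
  induction k generalizing x y with
  | zero => rcases x with _ | x <;> rcases y with _ | y <;> simp [qA]
  | succ k ih =>
    rcases x with _ | x <;> rcases y with _ | y <;> simp [qA, mul_add, ih]

lemma qA_tendsto (k : ℕ) (g : ℕ → ℕ → ℝ) (h : ℕ → ℝ)
    (hg : ∀ z, Filter.Tendsto (fun n => g n z) Filter.atTop (nhds (h z))) (x y : ℕ) :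
    Filter.Tendsto (fun n => qA k (g n) x y) Filter.atTop (nhds (qA k h x y)) := by
  induction k generalizing x y with
  | zero => rcases x with _ | x <;> rcases y with _ | y <;> simp [qA, hg]
  | succ k ih =>
    rcases x with _ | x <;> rcases y with _ | y <;> simp only [qA]
    · exact tendsto_const_nhds
    · exact tendsto_const_nhds
    · exact tendsto_const_nhds
    · exact ((ih _ _).add (ih _ _)).add (ih _ _)

lemma qA_nonneg (k : ℕ) (g : ℕ → ℝ) (hg : ∀ z, 0 ≤ g z) (x y : ℕ) : 0 ≤ qA k g x y := by
  induction k generalizing x y with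
  | zero => rcases x with _ | x <;> rcases y with _ | y <;> simp [qA, hg]
  | succ k ih =>
    rcases x with _ | x <;> rcases y with _ | y <;> simp only [qA]
    · exact le_rfl
    · exact le_rfl
    · exact le_rfl
    · exact add_nonneg (add_nonneg (ih _ _) (ih _ _)) (ih _ _)

lemma qA_le (k : ℕ) (g : ℕ → ℝ) (C : ℝ) (hC : 0 ≤ C) (hg : ∀ z : ℕ, g z ≤ C * z) (x y : ℕ) :
    qA k g x y ≤ C * (x + k) * (17/6)^k * (3/4)^y := by
  induction k generalizing x y with
  | zero =>
    rcases x with _ | x <;> rcases y with _ | y <;> simp only [qA]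
    · positivity
    · positivity
    · simpa using hg (x+1)
    · positivity
  | succ k ih =>
    rcases x with _ | x <;> rcases y with _ | y <;> simp only [qA]
    · positivity
    · positivity
    · positivity
    · have h1 := ih x (y+2)
      have h2 := ih (x+1) (y+2)
      have h3 := ih (x+2) y
      push_cast at *
      set P : ℝ := (17/6)^k with hP
      set Q : ℝ := (3/4)^y with hQ
      have hq : (0:ℝ) ≤ C * P * Q := by positivity
      have e : ((3:ℝ)/4)^(y+2) = Q * (9/16) := by rw [pow_add]; norm_num [hQ]
      have e1 : ((3:ℝ)/4)^(y+1) = Q * (3/4) := by rw [pow_succ]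
      have e2 : ((17:ℝ)/6)^(k+1) = P * (17/6) := by rw [pow_succ]
      rw [e] at h1 h2
      rw [e1, e2]
      nlinarith

open Real MeasureTheory Filter Topology

noncomputable def qK : ℕ → ℝ → ℝ
  | 0, _ => 0
  | x+1, t => qK x t + Real.cos (x * t) + Real.cos ((x+1) * t)

lemma qK_rec (x : ℕ) (t : ℝ) :
    (1 + 2 * Real.cos t) * qK (x+1) t = qK x t + qK (x+1) t + qK (x+2) t := by
  induction x with
  | zero =>
    simp only [qK]
    push_cast
    have : Real.cos ((1+1) * t) = 2 * Real.cos t ^ 2 - 1 := by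
      rw [← Real.cos_two_mul]; norm_num
    rw [this]
    simp
    ring
  | succ x ih =>
    have key : ∀ s : ℝ, 2 * Real.cos t * Real.cos s = Real.cos (s - t) + Real.cos (s + t) := by
      intro s; rw [Real.cos_sub, Real.cos_add]; ring
    have k1 := key ((x+1) * t)
    have k2 := key ((x+1+1) * t)
    rw [show ((x:ℝ)+1)*t - t = x * t by ring, show ((x:ℝ)+1)*t + t = (x+1+1) * t by ring] at k1
    rw [show ((x:ℝ)+1+1)*t - t = (x+1) * t by ring, show ((x:ℝ)+1+1)*t + t = (x+1+1+1) * t by ring] at k2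
    have a1 : qK (x+1+2) t = qK (x+2) t + Real.cos ((x+1+1) * t) + Real.cos ((x+1+1+1) * t) := by
      rw [show x+1+2 = (x+2)+1 by ring, qK]; push_cast; ring_nf
    have a2 : qK (x+1+1) t = qK (x+1) t + Real.cos ((x+1) * t) + Real.cos ((x+1+1) * t) := by
      rw [qK]; push_cast; ring_nf
    have a4 : qK (x+2) t = qK (x+1+1) t := rfl
    have a3 : qK (x+1) t = qK x t + Real.cos (x * t) + Real.cos ((x+1) * t) := by
      rw [qK]
    rw [a4] at a1 ih
    rw [a1]
    linear_combination ih + (1 + 2 * Real.cos t) * a2 + k1 + k2 - a2 - a3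

lemma qK_cont (x : ℕ) : Continuous (qK x) := by
  induction x with
  | zero => exact continuous_const
  | succ x ih =>
    have : qK (x+1) = fun t => qK x t + Real.cos (x * t) + Real.cos ((x+1) * t) := by
      funext t; rw [qK]
    rw [this]; fun_prop

lemma qK_abs (x : ℕ) (t : ℝ) : |qK x t| ≤ 2 * x := by
  induction x with
  | zero => simp [qK]
  | succ x ih =>
    rw [qK]
    have h1 := Real.abs_cos_le_one (x * t)
    have h2 := Real.abs_cos_le_one ((x+1) * t)
    have := abs_add_three (qK x t) (Real.cos (x * t)) (Real.cos ((x+1) * t))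
    push_cast; linarith

lemma qK_at_zero (x : ℕ) : qK x 0 = 2 * x := by
  induction x with
  | zero => simp [qK]
  | succ x ih => rw [qK, ih]; push_cast; simp; ring

lemma int_cos_nat (x : ℕ) : ∫ t in (-π)..π, Real.cos (((x:ℝ)+1) * t) = 0 := by
  have hx : ((x:ℝ)+1) ≠ 0 := by positivity
  rw [intervalIntegral.integral_comp_mul_left (fun s => Real.cos s) hx, integral_cos]
  have h : Real.sin (((x:ℝ)+1) * π) = 0 := by
    have := Real.sin_nat_mul_pi (x+1); push_cast at this; exact this
  rw [mul_neg, Real.sin_neg, h]; simp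

lemma int_qK (x : ℕ) : ∫ t in (-π)..π, qK (x+1) t = 2 * π := by
  induction x with
  | zero =>
    simp only [qK]
    have h := int_cos_nat 0
    push_cast at *
    rw [intervalIntegral.integral_add (Continuous.intervalIntegrable (by fun_prop) _ _)
      (Continuous.intervalIntegrable (by fun_prop) _ _), h]
    simp; ring
  | succ x ih =>
    have h := int_cos_nat x
    have h2 := int_cos_nat (x+1)
    have e : qK (x+1+1) = fun t => (qK (x+1) t + Real.cos ((x+1) * t)) + Real.cos ((x+1+1) * t) := by
      funext t; rw [qK]; push_cast; rfl
    have hc := qK_cont (x+1)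
    push_cast at *
    rw [e]
    rw [intervalIntegral.integral_add (Continuous.intervalIntegrable (by fun_prop) _ _)
      (Continuous.intervalIntegrable (by fun_prop) _ _),
      intervalIntegral.integral_add (Continuous.intervalIntegrable (by fun_prop) _ _)
      (Continuous.intervalIntegrable (by fun_prop) _ _), ih, h, h2]
    ring

lemma qM_integral (n x : ℕ) :
    2 * π * qM n x = ∫ t in (-π)..π, (1 + 2 * Real.cos t)^n * qK x t := by
  induction n generalizing x with
  | zero =>
    cases x with
    | zero => simp [qM, qK]
    | succ x => simp [qM, int_qK]
  | succ n ih =>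
    cases x with
    | zero => simp [qM, qK]
    | succ x =>
      have e : ∀ t, (1 + 2 * Real.cos t)^(n+1) * qK (x+1) t =
          ((1 + 2 * Real.cos t)^n * qK x t + (1 + 2 * Real.cos t)^n * qK (x+1) t)
            + (1 + 2 * Real.cos t)^n * qK (x+2) t := by
        intro t; rw [pow_succ, mul_assoc, qK_rec]; ring
      simp only [e]
      have h0 := qK_cont x
      have h1 := qK_cont (x+1)
      have h2 := qK_cont (x+2)
      rw [intervalIntegral.integral_add (Continuous.intervalIntegrable (by fun_prop) _ _)
        (Continuous.intervalIntegrable (by fun_prop) _ _),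
        intervalIntegral.integral_add (Continuous.intervalIntegrable (by fun_prop) _ _)
        (Continuous.intervalIntegrable (by fun_prop) _ _), ← ih, ← ih, ← ih, qM]
      ring

noncomputable def qH (n x : ℕ) : ℝ → ℝ :=
  (Set.Ioc (-π) π).indicator (fun t => ((1 + 2 * Real.cos t)/3)^n * qK x t)

lemma qH_integral (n x : ℕ) : qM n x / 3^n = (2*π)⁻¹ * ∫ t, qH n x t := by
  unfold qH
  rw [integral_indicator measurableSet_Ioc, ← intervalIntegral.integral_of_le (by linarith [Real.pi_pos])]
  have : ∀ t, ((1 + 2 * Real.cos t)/3)^n * qK x t = (3^n)⁻¹ * ((1 + 2 * Real.cos t)^n * qK x t) := by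
    intro t; rw [div_pow]; ring
  simp only [this]
  rw [intervalIntegral.integral_const_mul, ← qM_integral]
  have := Real.pi_pos
  field_simp

lemma qH_scaled (n x : ℕ) (hn : 1 ≤ n) :
    qM n x * √n / 3^n = (2*π)⁻¹ * ∫ u, qH n x ((√n)⁻¹ * u) := by
  rw [Measure.integral_comp_mul_left, inv_inv, abs_of_nonneg (Real.sqrt_nonneg _), smul_eq_mul]
  rw [mul_div_right_comm, qH_integral]; ring

lemma base_bound (t : ℝ) (ht : |t| ≤ π) : |(1 + 2 * Real.cos t)/3| ≤ Real.exp (-(1/10) * t^2) := by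
  have hpi := Real.pi_pos
  have hp2 : π^2 < 10 := by nlinarith [Real.pi_lt_d2]
  have h1 := Real.cos_le_one_sub_mul_cos_sq ht
  have ht2 : t^2 ≤ π^2 := by rw [← sq_abs]; gcongr
  rw [abs_le]
  constructor
  · have : (1:ℝ)/3 ≤ Real.exp (-(1/10) * t^2) := by
      calc (1:ℝ)/3 ≤ Real.exp (-1) := by
            rw [Real.exp_neg, one_div]
            exact inv_anti₀ (Real.exp_pos 1) (by linarith [Real.exp_one_lt_d9])
        _ ≤ _ := Real.exp_le_exp.2 (by nlinarith)
    linarith [Real.neg_one_le_cos t]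
  · have h2 := Real.add_one_le_exp (-(1/10) * t^2)
    have h3 : (1/5:ℝ) ≤ 2/π^2 := by rw [le_div_iff₀ (by positivity)]; linarith
    have : 1/5 * t^2 ≤ 2/π^2 * t^2 := by gcongr
    nlinarith [sq_nonneg t]

lemma qH_bound (n x : ℕ) (hn : 1 ≤ n) (u : ℝ) :
    |qH n x ((√n)⁻¹ * u)| ≤ 2 * x * Real.exp (-(1/10) * u^2) := by
  unfold qH
  by_cases h : (√n)⁻¹ * u ∈ Set.Ioc (-π) π
  · rw [Set.indicator_of_mem h, abs_mul, abs_pow, mul_comm (2 * (x:ℝ))]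
    have hn' : (0:ℝ) < n := by exact_mod_cast hn
    have hb := base_bound _ (abs_le.2 ⟨h.1.le, h.2⟩)
    have : |(1 + 2 * Real.cos ((√n)⁻¹ * u))/3|^n ≤ Real.exp (-(1/10) * u^2) := by
      calc _ ≤ (Real.exp (-(1/10) * ((√n)⁻¹ * u)^2))^n := by gcongr
        _ = _ := by
          rw [← Real.exp_nat_mul, mul_pow, inv_pow, Real.sq_sqrt hn'.le]
          congr 1; field_simp
    exact mul_le_mul this (qK_abs _ _) (abs_nonneg _) (Real.exp_nonneg _)
  · rw [Set.indicator_of_notMem h]; simp; positivity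

lemma qH_int (n x : ℕ) (c : ℝ) : AEStronglyMeasurable (fun u => qH n x (c * u)) volume := by
  have : Measurable (qH n x) := by
    unfold qH
    refine Measurable.indicator ?_ measurableSet_Ioc
    have := qK_cont x
    exact Continuous.measurable (by fun_prop)
  exact (this.comp (measurable_const_mul c)).aestronglyMeasurable

lemma qM_bound : ∃ C : ℝ, 0 ≤ C ∧ ∀ n x : ℕ, qM n x * √n / 3^n ≤ C * x := by
  refine ⟨(2*π)⁻¹ * (2 * ∫ u, Real.exp (-(1/10) * u^2)), ?_, ?_⟩
  · have := Real.pi_pos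
    have : 0 ≤ ∫ u, Real.exp (-(1/10) * u^2) := integral_nonneg (fun u => Real.exp_nonneg _)
    positivity
  intro n x
  rcases Nat.eq_zero_or_pos n with rfl | hn
  · simp
    have := Real.pi_pos
    have : 0 ≤ ∫ u, Real.exp (-(10⁻¹ * u^2)) := integral_nonneg (fun u => Real.exp_nonneg _)
    positivity
  rw [qH_scaled n x hn]
  have h : ∫ u, qH n x ((√n)⁻¹ * u) ≤ ∫ u, 2 * x * Real.exp (-(1/10) * u^2) := by
    have hi : Integrable (fun u : ℝ => 2 * (x:ℝ) * Real.exp (-(1/10) * u^2)) :=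
      (integrable_exp_neg_mul_sq (by norm_num)).const_mul _
    refine integral_mono (hi.mono' (qH_int _ _ _) ?_) hi ?_
    · exact Eventually.of_forall (fun u => qH_bound n x hn u)
    · exact fun u => (le_abs_self _).trans (qH_bound n x hn u)
  rw [integral_const_mul] at h
  have hp : 0 ≤ (2*π)⁻¹ := by have := Real.pi_pos; positivity
  calc _ ≤ _ := mul_le_mul_of_nonneg_left h hp
    _ = _ := by ring

lemma tendsto_scale (u : ℝ) : Tendsto (fun n : ℕ => (√(n:ℝ))⁻¹ * u) atTop (𝓝 0) := by
  have : Tendsto (fun n : ℕ => (√(n:ℝ))⁻¹) atTop (𝓝 0) :=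
    tendsto_inv_atTop_zero.comp (Real.tendsto_sqrt_atTop.comp tendsto_natCast_atTop_atTop)
  simpa using this.mul_const u

lemma tendsto_cos_scale (u : ℝ) :
    Tendsto (fun n : ℕ => (n:ℝ) * (2/3 * (Real.cos ((√(n:ℝ))⁻¹ * u) - 1))) atTop (𝓝 (-(1/3) * u^2)) := by
  rw [← tendsto_sub_nhds_zero_iff]
  have h0 : Tendsto (fun n : ℕ => u^4 * (n:ℝ)⁻¹) atTop (𝓝 0) := by
    simpa using (tendsto_inv_atTop_nhds_zero_nat (𝕜 := ℝ)).const_mul (u^4)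
  refine squeeze_zero_norm' ?_ h0
  have h1 : ∀ᶠ n : ℕ in atTop, |(√(n:ℝ))⁻¹ * u| < 1 := by
    have := (tendsto_scale u).abs
    rw [abs_zero] at this
    exact this.eventually_lt_const one_pos
  filter_upwards [h1, eventually_ge_atTop 1] with n hn hn1
  have hn' : (0:ℝ) < n := by exact_mod_cast hn1
  have hb := Real.cos_bound hn.le
  set s := (√(n:ℝ))⁻¹ * u with hs
  have hs2 : (n:ℝ) * s^2 = u^2 := by
    rw [hs, mul_pow, inv_pow, Real.sq_sqrt hn'.le]; field_simp
  have hs4 : (n:ℝ) * |s|^4 = u^4 * (n:ℝ)⁻¹ := by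
    have : |s|^4 = (s^2)^2 := by rw [← sq_abs s]; ring
    have h2 : s^2 = u^2 / n := by field_simp; linarith
    rw [this, h2]; field_simp
  have e : (n:ℝ) * (2/3 * (Real.cos s - 1)) - -(1/3) * u^2 = n * (2/3 * (Real.cos s - (1 - s^2/2))) := by
    rw [← hs2]; ring
  rw [e, Real.norm_eq_abs, abs_mul, abs_mul, abs_of_pos hn', ← hs4]
  rw [abs_of_pos (by norm_num : (0:ℝ) < 2/3)]
  have : 0 ≤ |s|^4 := by positivity
  exact mul_le_mul_of_nonneg_left (by linarith) hn'.le

lemma qH_tendsto (x : ℕ) (u : ℝ) :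
    Tendsto (fun n : ℕ => qH n x ((√(n:ℝ))⁻¹ * u)) atTop (𝓝 (2 * x * Real.exp (-(1/3) * u^2))) := by
  have h1 : ∀ᶠ n : ℕ in atTop, (√(n:ℝ))⁻¹ * u ∈ Set.Ioc (-π) π :=
    (tendsto_scale u).eventually (Ioc_mem_nhds (by linarith [Real.pi_pos]) Real.pi_pos)
  have h2 := Real.tendsto_one_add_pow_exp_of_tendsto (tendsto_cos_scale u)
  have h3 := ((qK_cont x).tendsto 0).comp (tendsto_scale u)
  rw [qK_at_zero] at h3
  have h4 := h2.mul h3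
  rw [mul_comm] at h4
  refine h4.congr' ?_
  filter_upwards [h1] with n hn
  rw [qH, Set.indicator_of_mem hn]
  simp only [Function.comp]
  congr 2; ring

lemma qM_tendsto (x : ℕ) :
    Tendsto (fun n : ℕ => qM n x * √n / 3^n) atTop (𝓝 (√(3/π) * x)) := by
  have h : Tendsto (fun n : ℕ => ∫ u, qH n x ((√(n:ℝ))⁻¹ * u)) atTop
      (𝓝 (∫ u, 2 * x * Real.exp (-(1/3) * u^2))) := by
    refine tendsto_integral_filter_of_dominated_convergence
      (fun u => 2 * x * Real.exp (-(1/10) * u^2)) ?_ ?_ ?_ ?_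
    · exact Eventually.of_forall (fun n => qH_int _ _ _)
    · filter_upwards [eventually_ge_atTop 1] with n hn
      exact Eventually.of_forall (fun u => qH_bound n x hn u)
    · exact (integrable_exp_neg_mul_sq (by norm_num)).const_mul _
    · exact Eventually.of_forall (fun u => qH_tendsto x u)
  rw [integral_const_mul, integral_gaussian] at h
  have h' := h.const_mul (2*π)⁻¹
  have hpi := Real.pi_pos
  have e : (2*π)⁻¹ * (2 * x * √(π / (1/3))) = √(3/π) * x := by
    have : √(π / (1/3)) = π * √(3/π) := by
      rw [show π / (1/3) = π^2 * (3/π) by field_simp, Real.sqrt_mul (by positivity),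
        Real.sqrt_sq hpi.le]
    rw [this]; field_simp
  rw [e] at h'
  refine h'.congr' ?_
  filter_upwards [eventually_ge_atTop 1] with n hn
  rw [qH_scaled n x hn]

noncomputable def qF (n k : ℕ) : ℝ :=
  if k ≤ n then qA k (fun z => √n / 3^n * qM (n-k) z) 1 1 else 0

lemma qF_sum (n : ℕ) : (qW n 1 1 : ℝ) * √n / 3^n = qM n 1 * √n / 3^n - ∑' k, qF n k := by
  rw [tsum_eq_sum (s := Finset.range (n+1))]
  · have h := qM_decomp n 1 1
    have : ∑ k ∈ Finset.range (n+1), qF n k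
        = √n / 3^n * ∑ k ∈ Finset.range (n+1), qA k (qM (n-k)) 1 1 := by
      rw [Finset.mul_sum]
      refine Finset.sum_congr rfl (fun k hk => ?_)
      rw [qF, if_pos (by simpa [Nat.lt_succ_iff] using hk), qA_smul]
    rw [this, h]; ring
  · intro k hk
    rw [qF, if_neg (by simpa [Nat.lt_succ_iff] using hk)]

lemma qF_nonneg (n k : ℕ) : 0 ≤ qF n k := by
  rw [qF]; split_ifs
  · exact qA_nonneg _ _ (fun z => mul_nonneg (by positivity) (qM_nonneg _ _)) _ _
  · exact le_rfl

lemma qF_tendsto (k : ℕ) :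
    Tendsto (fun n => qF n k) atTop (𝓝 (qA k (fun z => (3^k)⁻¹ * (√(3/π) * z)) 1 1)) := by
  rw [← tendsto_add_atTop_iff_nat k]
  have e : ∀ m : ℕ, qF (m+k) k = qA k (fun z => √((m+k : ℕ):ℝ) / 3^(m+k) * qM m z) 1 1 := by
    intro m; rw [qF, if_pos (by omega)]; simp
  simp only [e]
  refine qA_tendsto k _ _ (fun z => ?_) 1 1
  have hr : Tendsto (fun m : ℕ => √(1 + k * (m:ℝ)⁻¹)) atTop (𝓝 1) := by
    have : Tendsto (fun m : ℕ => 1 + k * (m:ℝ)⁻¹) atTop (𝓝 1) := by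
      simpa using ((tendsto_inv_atTop_nhds_zero_nat (𝕜 := ℝ)).const_mul (k:ℝ)).const_add 1
    simpa using this.sqrt
  have h := ((hr.mul (qM_tendsto z)).const_mul ((3:ℝ)^k)⁻¹)
  rw [one_mul] at h
  refine h.congr' ?_
  filter_upwards [eventually_ge_atTop 1] with m hm
  have hm' : (0:ℝ) < m := by exact_mod_cast hm
  have : √((m+k : ℕ):ℝ) = √(1 + k * (m:ℝ)⁻¹) * √m := by
    rw [← Real.sqrt_mul (by positivity)]; congr 1; push_cast; field_simp
  rw [this, pow_add]; field_simp

lemma qF_le (C : ℝ) (hC0 : 0 ≤ C) (hC : ∀ n x : ℕ, qM n x * √n / 3^n ≤ C * x) (n k : ℕ) :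
    qF n k ≤ (k + C) * (1 + k) * (17/18)^k := by
  rw [qF]
  split_ifs with hk
  · obtain ⟨m, rfl⟩ := Nat.exists_eq_add_of_le hk
    have hg : ∀ z : ℕ, √((k+m : ℕ):ℝ) / 3^(k+m) * qM (k+m-k) z ≤ ((3^k)⁻¹ * (k + C)) * z := by
      intro z
      rw [Nat.add_sub_cancel_left]
      have h1 := hC m z
      have h2 : qM m z / 3^m ≤ z := by rw [div_le_iff₀ (by positivity)]; linarith [qM_le m z]
      have h20 : 0 ≤ qM m z / 3^m := div_nonneg (qM_nonneg _ _) (by positivity)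
      have h3 : √((k+m : ℕ):ℝ) ≤ k + √m := by
        rw [Real.sqrt_le_left (by positivity)]
        have := Real.sq_sqrt (Nat.cast_nonneg (α := ℝ) m)
        have hkk : (k:ℝ) ≤ (k:ℝ)^2 := by exact_mod_cast Nat.le_self_pow two_ne_zero k
        have : 0 ≤ (k:ℝ) * √m := by positivity
        push_cast; nlinarith
      have h4 : √((k+m : ℕ):ℝ) * (qM m z / 3^m) ≤ (k + C) * z := by
        calc _ ≤ (k + √m) * (qM m z / 3^m) := mul_le_mul_of_nonneg_right h3 h20
          _ = k * (qM m z / 3^m) + qM m z * √m / 3^m := by ring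
          _ ≤ k * z + C * z := add_le_add (mul_le_mul_of_nonneg_left h2 (by positivity)) h1
          _ = _ := by ring
      calc _ = (3^k)⁻¹ * (√((k+m : ℕ):ℝ) * (qM m z / 3^m)) := by rw [pow_add]; field_simp
        _ ≤ (3^k)⁻¹ * ((k + C) * z) := mul_le_mul_of_nonneg_left h4 (by positivity)
        _ = _ := by ring
    have h := qA_le k _ _ (by positivity) hg 1 1
    refine h.trans ?_
    have e : ((17:ℝ)/18)^k = (3^k)⁻¹ * (17/6)^k := by
      rw [← inv_pow, ← mul_pow]; norm_num
    rw [e]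
    have : 0 ≤ (k + C) * (1 + (k:ℝ)) * ((3^k)⁻¹ * (17/6)^k) := by positivity
    push_cast
    nlinarith
  · positivity

lemma qbound_summable (C : ℝ) : Summable (fun k : ℕ => (k + C) * (1 + (k:ℝ)) * (17/18)^k) := by
  have h := fun j : ℕ => summable_pow_mul_geometric_of_norm_lt_one (R := ℝ) j
    (r := 17/18) (by norm_num [abs_of_pos])
  refine ((h 2).add (((h 1).mul_left (1 + C)).add ((h 0).mul_left C))).congr (fun k => ?_)
  ring

theorem modelD_asymptotics :
    ∃ κ : ℝ, 0 ≤ κ ∧ κ ≤ Real.sqrt (3 / Real.pi) ∧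
      Filter.Tendsto
        (fun n : ℕ =>
          (quarterPlaneWalks ({(-1,1),(0,1),(1,-1)} : Finset (ℤ × ℤ)) n : ℝ) *
            Real.sqrt n / 3 ^ n)
        Filter.atTop (nhds κ) := by
  obtain ⟨C, hC0, hC⟩ := qM_bound
  have hW : ∀ n, quarterPlaneWalks ({(-1,1),(0,1),(1,-1)} : Finset (ℤ × ℤ)) n = qW n 1 1 := by
    intro n
    rw [← qP_card]
    unfold quarterPlaneWalks
    rw [← Nat.card_coe_set_eq]
    simp only [qP, qS, Set.coe_ofPred]
    simp
  simp only [hW]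
  have ht := tendsto_tsum_of_dominated_convergence (qbound_summable C) qF_tendsto
    (Eventually.of_forall (fun n k => by
      rw [Real.norm_eq_abs, abs_of_nonneg (qF_nonneg n k)]
      exact qF_le C hC0 hC n k))
  have h1 := (qM_tendsto 1)
  rw [Nat.cast_one, mul_one] at h1
  have h2 := h1.sub ht
  have h3 := h2.congr (fun n => (qF_sum n).symm)
  refine ⟨_, ge_of_tendsto' h3 (fun n => by positivity), le_of_tendsto_of_tendsto' h3 h1 ?_, h3⟩
  intro n
  rw [qF_sum]
  have : 0 ≤ ∑' k, qF n k := tsum_nonneg (qF_nonneg n)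
  linarith
end

section
/- Let E_n denote the number of quarter-plane walks of length n with steps from ℰ = {(−1,1),(0,1),(1,1),(1,−1)}. Then there exist a real constant κ with 122/525 ≤ κ ≤ 7/10 and a constant C > 0 such that for all n ≥ 0, |E_n − κ·4^n| ≤ C·(1+2√2)^n. -/
/-- The step set. -/
def stepsE : Finset (ℤ × ℤ) := {(-1,1),(0,1),(1,1),(1,-1)}

/-- Walks started at an arbitrary point. -/
def WalkP (n : ℕ) (a b : ℤ) (f : Fin n → ℤ × ℤ) : Prop :=
  (∀ k, f k ∈ stepsE) ∧
    ∀ k : Fin n, 0 ≤ a + ∑ j ∈ Finset.Iic k, (f j).1 ∧ 0 ≤ b + ∑ j ∈ Finset.Iic k, (f j).2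

/-- Number of walks of length `n` started at `(a,b)`; zero outside the quadrant. -/
def G : ℕ → ℤ → ℤ → ℕ
  | 0, a, b => if 0 ≤ a ∧ 0 ≤ b then 1 else 0
  | n + 1, a, b => if 0 ≤ a ∧ 0 ≤ b then
      G n (a - 1) (b + 1) + G n a (b + 1) + G n (a + 1) (b + 1) + G n (a + 1) (b - 1) else 0

lemma G_out (n : ℕ) (a b : ℤ) (h : ¬ (0 ≤ a ∧ 0 ≤ b)) : G n a b = 0 := by
  cases n <;> simp only [G, if_neg h]

lemma G_succ (n : ℕ) (a b : ℤ) (h : 0 ≤ a ∧ 0 ≤ b) : G (n + 1) a b =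
    G n (a - 1) (b + 1) + G n a (b + 1) + G n (a + 1) (b + 1) + G n (a + 1) (b - 1) := by
  rw [G, if_pos h]

lemma sum_Iic_zero (n : ℕ) (g : Fin (n + 1) → ℤ) :
    ∑ j ∈ Finset.Iic (0 : Fin (n + 1)), g j = g 0 := by
  have : Finset.Iic (0 : Fin (n + 1)) = {0} := by
    ext x; simp
  rw [this, Finset.sum_singleton]

lemma sum_Iic_succ (n : ℕ) (g : Fin (n + 1) → ℤ) (k : Fin n) :
    ∑ j ∈ Finset.Iic k.succ, g j = g 0 + ∑ j ∈ Finset.Iic k, g j.succ := by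
  have h1 : ∀ (m : ℕ) (k : Fin m), Finset.Iic k = Finset.univ.filter (fun j => j ≤ k) := by
    intro m k; ext x; simp
  rw [h1, h1, Finset.sum_filter, Finset.sum_filter, Fin.sum_univ_succ]
  simp

lemma walkP_cons (n : ℕ) (a b : ℤ) (s : ℤ × ℤ) (f : Fin n → ℤ × ℤ) :
    WalkP (n + 1) a b (Fin.cons s f) ↔
      (s ∈ stepsE ∧ 0 ≤ a + s.1 ∧ 0 ≤ b + s.2) ∧ WalkP n (a + s.1) (b + s.2) f := by
  unfold WalkP
  rw [Fin.forall_fin_succ, Fin.forall_fin_succ]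
  simp only [sum_Iic_zero, sum_Iic_succ, Fin.cons_zero, Fin.cons_succ, add_assoc]
  tauto

lemma walkP_finite (n : ℕ) (a b : ℤ) : Finite {f // WalkP n a b f} := by
  apply Set.Finite.subset (s := (Fintype.piFinset (fun _ : Fin n => stepsE) : Set _))
  · exact Finset.finite_toSet _
  · intro f hf
    simpa using hf.1

/-- Decomposition by first step. -/
noncomputable def walkEquiv (n : ℕ) (a b : ℤ) : {f // WalkP (n + 1) a b f} ≃
    Σ s : {s : stepsE // 0 ≤ a + s.1.1 ∧ 0 ≤ b + s.1.2},
      {f // WalkP n (a + s.1.1.1) (b + s.1.1.2) f} where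
  toFun f := ⟨⟨⟨f.1 0, ((walkP_cons n a b (f.1 0) (Fin.tail f.1)).1
      (by rw [Fin.cons_self_tail]; exact f.2)).1.1⟩,
      ((walkP_cons n a b (f.1 0) (Fin.tail f.1)).1
      (by rw [Fin.cons_self_tail]; exact f.2)).1.2⟩, ⟨Fin.tail f.1,
      ((walkP_cons n a b (f.1 0) (Fin.tail f.1)).1
      (by rw [Fin.cons_self_tail]; exact f.2)).2⟩⟩
  invFun p := ⟨Fin.cons p.1.1.1 p.2.1, (walkP_cons n a b _ _).2 ⟨⟨p.1.1.2, p.1.2⟩, p.2.2⟩⟩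
  left_inv f := by
    apply Subtype.ext
    exact Fin.cons_self_tail f.1
  right_inv p := by
    obtain ⟨⟨⟨s, hs⟩, h⟩, ⟨f, hf⟩⟩ := p
    rfl

lemma card_walk (n : ℕ) : ∀ a b : ℤ, 0 ≤ a → 0 ≤ b → Nat.card {f // WalkP n a b f} = G n a b := by
  induction n with
  | zero =>
    intro a b ha hb
    have : ∀ f, WalkP 0 a b f := fun f => ⟨fun k => k.elim0, fun k => k.elim0⟩
    simp [G, ha, hb, this]
  | succ n ih =>
    intro a b ha hb
    rw [Nat.card_congr (walkEquiv n a b)]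
    have := walkP_finite n
    rw [Nat.card_sigma]
    have h1 : ∀ s : {s : stepsE // 0 ≤ a + s.1.1 ∧ 0 ≤ b + s.1.2},
      Nat.card {f // WalkP n (a + s.1.1.1) (b + s.1.1.2) f}
        = (fun s : stepsE => G n (a + s.1.1) (b + s.1.2)) s.1 := fun s => ih _ _ s.2.1 s.2.2
    rw [Finset.sum_congr rfl (fun s _ => h1 s)]
    rw [← Finset.sum_subtype
      (Finset.univ.filter (fun s : stepsE => 0 ≤ a + s.1.1 ∧ 0 ≤ b + s.1.2)) (by simp)
      (fun s : stepsE => G n (a + s.1.1) (b + s.1.2)), Finset.sum_filter]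
    have h2 : ∀ s : stepsE, (if 0 ≤ a + s.1.1 ∧ 0 ≤ b + s.1.2 then
        G n (a + s.1.1) (b + s.1.2) else 0) = G n (a + s.1.1) (b + s.1.2) := by
      intro s
      split_ifs with h
      · rfl
      · exact (G_out _ _ _ h).symm
    rw [Finset.sum_congr rfl (fun s _ => h2 s),
      Finset.sum_coe_sort stepsE (fun s => G n (a + s.1) (b + s.2)), G, if_pos ⟨ha, hb⟩, stepsE]
    rw [Finset.sum_insert (by decide), Finset.sum_insert (by decide),
      Finset.sum_insert (by decide), Finset.sum_singleton]
    simp only [add_zero, ← sub_eq_add_neg]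
    ring

theorem lower (n : ℕ) : ∀ a b : ℤ,
    (4:ℝ) ^ n * (1 - (1/2:ℝ) ^ (a + 1) - (1/3:ℝ) ^ (b + 1)) ≤ G n a b := by
  have hout : ∀ (n : ℕ) (a b : ℤ), ¬ (0 ≤ a ∧ 0 ≤ b) →
      (4:ℝ) ^ n * (1 - (1/2:ℝ) ^ (a + 1) - (1/3:ℝ) ^ (b + 1)) ≤ G n a b := by
    intro n a b h
    rw [G_out n a b h]
    have h2 : (0:ℝ) < (1/2:ℝ) ^ (a + 1) := by positivity
    have h3 : (0:ℝ) < (1/3:ℝ) ^ (b + 1) := by positivity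
    have : 1 ≤ (1/2:ℝ) ^ (a + 1) ∨ 1 ≤ (1/3:ℝ) ^ (b + 1) := by
      by_cases ha : 0 ≤ a
      · right
        exact one_le_zpow_of_nonpos₀ (by norm_num) (by norm_num) (by omega)
      · left
        exact one_le_zpow_of_nonpos₀ (by norm_num) (by norm_num) (by omega)
    rw [Nat.cast_zero]
    apply mul_nonpos_of_nonneg_of_nonpos (by positivity)
    rcases this with h | h <;> linarith
  induction n with
  | zero =>
    intro a b
    by_cases h : 0 ≤ a ∧ 0 ≤ b
    · simp only [G, if_pos h]
      have h2 : (0:ℝ) < (1/2:ℝ) ^ (a + 1) := by positivity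
      have h3 : (0:ℝ) < (1/3:ℝ) ^ (b + 1) := by positivity
      push_cast; linarith
    · exact hout _ a b h
  | succ n ih =>
    intro a b
    by_cases h : 0 ≤ a ∧ 0 ≤ b
    · simp only [G, if_pos h]
      have i1 := ih (a - 1) (b + 1)
      have i2 := ih a (b + 1)
      have i3 := ih (a + 1) (b + 1)
      have i4 := ih (a + 1) (b - 1)
      rw [sub_add_cancel] at i1 i4
      push_cast
      refine le_trans (le_of_eq ?_) (add_le_add (add_le_add (add_le_add i1 i2) i3) i4)
      have hh : (1/2:ℝ) ≠ 0 := by norm_num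
      have ht : (1/3:ℝ) ≠ 0 := by norm_num
      simp only [zpow_add₀ hh, zpow_add₀ ht, zpow_one]
      ring
    · exact hout _ a b h

theorem defect_nonneg (n : ℕ) : ∀ a b : ℤ, G (n + 1) a b ≤ 4 * G n a b := by
  induction n with
  | zero =>
    intro a b
    by_cases h : 0 ≤ a ∧ 0 ≤ b
    · simp only [G, if_pos h]
      split_ifs <;> omega
    · rw [G_out _ a b h]; omega
  | succ n ih =>
    intro a b
    by_cases h : 0 ≤ a ∧ 0 ≤ b
    · rw [G_succ (n + 1) a b h, G_succ n a b h]
      have i1 := ih (a - 1) (b + 1)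
      have i2 := ih a (b + 1)
      have i3 := ih (a + 1) (b + 1)
      have i4 := ih (a + 1) (b - 1)
      omega
    · rw [G_out _ a b h]; omega

theorem defect_le (n : ℕ) : ∀ a b : ℤ, 4 * (G n a b : ℝ) - G (n + 1) a b ≤
    (1 + 2 * √2) ^ n * ((√2 / 2) ^ a + (1/2:ℝ) ^ b) := by
  have hs : √2 * √2 = 2 := Real.mul_self_sqrt (by norm_num)
  have hs0 : 0 < √2 := by positivity
  have hs1 : 1.4 < √2 := by
    apply Real.lt_sqrt_of_sq_lt; norm_num
  induction n with
  | zero =>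
    intro a b
    have h2 : (0:ℝ) < (√2/2:ℝ) ^ a := by positivity
    have h3 : (0:ℝ) < (1/2:ℝ) ^ b := by positivity
    by_cases h : 0 ≤ a ∧ 0 ≤ b
    · simp only [G, if_pos h]
      have e2 : 0 ≤ a ∧ 0 ≤ b + 1 := by omega
      have e3 : 0 ≤ a + 1 ∧ 0 ≤ b + 1 := by omega
      rw [if_pos e2, if_pos e3]
      have k1 : (1:ℝ) - ((if 0 ≤ a - 1 ∧ 0 ≤ b + 1 then 1 else 0 : ℕ) : ℝ) ≤ (√2/2:ℝ) ^ a := by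
        split_ifs with q
        · push_cast; linarith
        · have : a = 0 := by omega
          subst this; simp
      have k2 : (1:ℝ) - ((if 0 ≤ a + 1 ∧ 0 ≤ b - 1 then 1 else 0 : ℕ) : ℝ) ≤ (1/2:ℝ) ^ b := by
        split_ifs with q
        · push_cast; linarith
        · have : b = 0 := by omega
          subst this; simp
      push_cast at k1 k2 ⊢
      linarith
    · rw [G_out _ a b h, G_out _ a b h]
      push_cast; linarith
  | succ n ih =>
    intro a b
    have h2 : (0:ℝ) < (√2/2:ℝ) ^ a := by positivity
    have h3 : (0:ℝ) < (1/2:ℝ) ^ b := by positivity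
    by_cases h : 0 ≤ a ∧ 0 ≤ b
    · rw [G_succ (n + 1) a b h, G_succ n a b h]
      have i1 := ih (a - 1) (b + 1)
      have i2 := ih a (b + 1)
      have i3 := ih (a + 1) (b + 1)
      have i4 := ih (a + 1) (b - 1)
      have hr : (√2/2:ℝ) ≠ 0 := by positivity
      have hh : (1/2:ℝ) ≠ 0 := by norm_num
      have hinv : (√2/2)⁻¹ = √2 := by
        rw [inv_eq_iff_eq_inv, eq_comm, inv_eq_iff_eq_inv]; field_simp; nlinarith
      simp only [zpow_add₀ hr, zpow_add₀ hh, zpow_sub₀ hr, zpow_sub₀ hh, zpow_one, div_eq_mul_inv _ (√2/2),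
        hinv] at i1 i2 i3 i4
      push_cast
      have hp : 0 ≤ (1 + 2 * √2) ^ n * (1/2:ℝ) ^ b * (2 * √2 - 5/2) := by
        apply mul_nonneg (by positivity); linarith
      rw [pow_succ]
      nlinarith [i1, i2, i3, i4, hp]
    · rw [G_out _ a b h, G_out _ a b h]
      push_cast
      have : 0 ≤ (1 + 2 * √2) ^ (n+1) * ((√2 / 2) ^ a + (1/2:ℝ) ^ b) := by positivity
      linarith

lemma walks_eq_s4 (n : ℕ) :
    quarterPlaneWalks ({(-1,1),(0,1),(1,1),(1,-1)} : Finset (ℤ × ℤ)) n = G n 0 0 := by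
  rw [← card_walk n 0 0 le_rfl le_rfl]
  simp only [WalkP, zero_add]
  rfl

theorem modelE_asymptotics :
    ∃ κ C : ℝ, 122 / 525 ≤ κ ∧ κ ≤ 7 / 10 ∧ 0 < C ∧ ∀ n : ℕ,
      |(quarterPlaneWalks ({(-1,1),(0,1),(1,1),(1,-1)} : Finset (ℤ × ℤ)) n : ℝ) - κ * 4 ^ n| ≤
        C * (1 + 2 * Real.sqrt 2) ^ n := by
  simp only [walks_eq_s4]
  have hs2 : √2 < 1.5 := by
    rw [Real.sqrt_lt' (by norm_num)]; norm_num
  set μ : ℝ := 1 + 2 * √2 with hμ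
  have hμ0 : 0 < μ := by positivity
  have hq : μ / 4 < 1 := by linarith
  let e : ℕ → ℝ := fun n => G n 0 0 / 4 ^ n
  have he : ∀ n, dist (e n) (e (n + 1)) ≤ (1/2) * (μ / 4) ^ n := by
    intro n
    have h1 := defect_le n 0 0
    have h2 : (G (n + 1) 0 0 : ℝ) ≤ 4 * G n 0 0 := by exact_mod_cast defect_nonneg n 0 0
    have h3 : e n - e (n + 1) = (4 * (G n 0 0 : ℝ) - G (n + 1) 0 0) / 4 ^ (n + 1) := by
      simp only [e]; field_simp; ring
    rw [Real.dist_eq, h3, abs_of_nonneg (div_nonneg (by linarith) (by positivity)),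
      div_le_iff₀ (by positivity), div_pow]
    simp only [zpow_zero] at h1
    refine h1.trans (le_of_eq ?_)
    field_simp
    ring
  have hanti : Antitone e := by
    apply antitone_nat_of_succ_le
    intro n
    have h2 : (G (n + 1) 0 0 : ℝ) ≤ 4 * G n 0 0 := by exact_mod_cast defect_nonneg n 0 0
    simp only [e]
    rw [div_le_div_iff₀ (by positivity) (by positivity), pow_succ]
    nlinarith [show (0:ℝ) < 4 ^ n by positivity]
  obtain ⟨κ, hκ⟩ := cauchySeq_tendsto_of_complete (cauchySeq_of_le_geometric _ _ hq he)
  have hd := dist_le_of_le_geometric_of_tendsto _ _ hq he hκ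
  refine ⟨κ, 1/2 / (1 - μ/4), ?_, ?_, ?_, ?_⟩
  · refine ge_of_tendsto hκ ?_
    filter_upwards [Filter.eventually_ge_atTop 1] with n hn
    obtain ⟨m, rfl⟩ := Nat.exists_eq_add_of_le' hn
    simp only [e]
    rw [le_div_iff₀ (by positivity), G, if_pos (by norm_num)]
    have l1 := lower m 0 (0 + 1)
    have l2 := lower m (0 + 1) (0 + 1)
    norm_num [zpow_ofNat] at l1 l2 ⊢
    have : (0:ℝ) < 4 ^ m := by positivity
    have g1 : (0:ℝ) ≤ G m (-1) 1 := by positivity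
    have g2 : (0:ℝ) ≤ G m 1 (-1) := by positivity
    rw [pow_succ]
    linarith
  · have h1 := hanti.le_of_tendsto hκ 1
    refine h1.trans ?_
    simp only [e]
    norm_num [G]
  · apply div_pos <;> linarith
  · intro n
    have h := hd n
    rw [Real.dist_eq] at h
    have h4 : (0:ℝ) < 4 ^ n := by positivity
    have : (G n 0 0 : ℝ) - κ * 4 ^ n = (e n - κ) * 4 ^ n := by
      simp only [e]; field_simp
    rw [this, abs_mul, abs_of_pos h4]
    refine (mul_le_mul_of_nonneg_right h h4.le).trans (le_of_eq ?_)
    rw [div_pow]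
    field_simp
end

section
/- Let A_n denote the number of quarter-plane walks of length n with steps from 𝒜 = {(−1,1),(1,1),(1,−1)}, and let A(t) = Σ_{n≥0} A_n t^n be the associated formal power series over ℚ. Then A(t) is not D-finite: there do not exist a natural number r and polynomials p_0,…,p_r ∈ ℚ[t], not all zero, such that Σ_{i=0}^r p_i(t)·A^{(i)}(t) = 0 as formal power series, where A^{(i)} denotes the i-th formal derivative. -/
/-- The counting generating function of quarter-plane walks with steps
from `S`, as a formal power series over ℚ. -/
noncomputable def walkGF (S : Finset (ℤ × ℤ)) : PowerSeries ℚ :=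
  PowerSeries.mk fun n => (quarterPlaneWalks S n : ℚ)


/-- One-step transfer operator on functions on the quadrant. -/
def qwT (g : ℕ → ℕ → ℂ) : ℕ → ℕ → ℂ := fun i j =>
  g (i+1) (j+1) + (if i = 0 then 0 else g (i-1) (j+1)) + (if j = 0 then 0 else g (i+1) (j-1))

def qwE (n : ℕ) (g : ℕ → ℕ → ℂ) : ℂ := (qwT^[n] g) 0 0

/-- Walks starting from `(i,j)`. -/
def qwSet (n : ℕ) (i j : ℤ) : Set (Fin n → ℤ × ℤ) :=
  {f | (∀ k, f k ∈ ({(-1,1),(1,1),(1,-1)} : Finset (ℤ × ℤ))) ∧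
    ∀ k : Fin n, 0 ≤ i + ∑ j ∈ Finset.Iic k, (f j).1 ∧ 0 ≤ j + ∑ j ∈ Finset.Iic k, (f j).2}

lemma qw_finite (n : ℕ) (i j : ℤ) : (qwSet n i j).Finite := by
  refine Set.Finite.subset (Finset.finite_toSet (Fintype.piFinset
    (fun _ : Fin n => ({(-1,1),(1,1),(1,-1)} : Finset (ℤ × ℤ))))) ?_
  intro f hf
  simpa [Fintype.mem_piFinset] using hf.1

lemma qw_sum_cons (n : ℕ) (h : ℤ × ℤ → ℤ) (s : ℤ × ℤ) (f : Fin n → ℤ × ℤ) (k : Fin n) :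
    ∑ j ∈ Finset.Iic k.succ, h ((Fin.cons s f : Fin (n+1) → ℤ × ℤ) j)
      = h s + ∑ j ∈ Finset.Iic k, h (f j) := by
  have : Finset.Iic k.succ = insert 0 ((Finset.Iic k).map (Fin.succEmb n)) := by
    ext x
    refine Fin.cases ?_ (fun y => ?_) x
    · simp
    · simp
  rw [this, Finset.sum_insert (by simp), Finset.sum_map]
  rfl

lemma qw_sum_cons_zero (n : ℕ) (h : ℤ × ℤ → ℤ) (s : ℤ × ℤ) (f : Fin n → ℤ × ℤ) :
    ∑ j ∈ Finset.Iic (0 : Fin (n+1)), h ((Fin.cons s f : Fin (n+1) → ℤ × ℤ) j)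
      = h s := by
  have : Finset.Iic (0 : Fin (n+1)) = {0} := by
    ext x; simp
  rw [this]; simp

lemma qw_cons_mem (n : ℕ) (i j : ℤ) (s : ℤ × ℤ) (f : Fin n → ℤ × ℤ) :
    (Fin.cons s f : Fin (n+1) → ℤ × ℤ) ∈ qwSet (n+1) i j ↔
      (s ∈ ({(-1,1),(1,1),(1,-1)} : Finset (ℤ × ℤ)) ∧ 0 ≤ i + s.1 ∧ 0 ≤ j + s.2) ∧
        f ∈ qwSet n (i + s.1) (j + s.2) := by
  simp only [qwSet, Set.mem_ofPred_eq, Fin.forall_fin_succ, Fin.cons_zero, Fin.cons_succ]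
  have h1 := qw_sum_cons n Prod.fst s f
  have h2 := qw_sum_cons n Prod.snd s f
  have h3 := qw_sum_cons_zero n Prod.fst s f
  have h4 := qw_sum_cons_zero n Prod.snd s f
  simp only [h1, h2, h3, h4, add_assoc]
  tauto

lemma qw_ncard_image (n : ℕ) (s : ℤ × ℤ) (A : Set (Fin n → ℤ × ℤ)) :
    ((fun f => (Fin.cons s f : Fin (n+1) → ℤ × ℤ)) '' A).ncard = A.ncard :=
  Set.ncard_image_of_injective _ (Fin.cons_right_injective (α := fun _ => ℤ × ℤ) s)

def qwC (n : ℕ) (i j : ℤ) (s : ℤ × ℤ) : Set (Fin (n+1) → ℤ × ℤ) :=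
  if 0 ≤ i + s.1 ∧ 0 ≤ j + s.2 then
    (fun f => (Fin.cons s f : Fin (n+1) → ℤ × ℤ)) '' (qwSet n (i + s.1) (j + s.2)) else ∅

lemma qwC_ncard (n : ℕ) (i j : ℤ) (s : ℤ × ℤ) : (qwC n i j s).ncard =
    if 0 ≤ i + s.1 ∧ 0 ≤ j + s.2 then (qwSet n (i + s.1) (j + s.2)).ncard else 0 := by
  unfold qwC
  split_ifs
  · rw [qw_ncard_image]
  · simp

lemma qwC_finite (n : ℕ) (i j : ℤ) (s : ℤ × ℤ) : (qwC n i j s).Finite := by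
  unfold qwC
  split_ifs
  · exact (qw_finite _ _ _).image _
  · exact Set.finite_empty

lemma qwC_zero (n : ℕ) (i j : ℤ) (s : ℤ × ℤ) (f) (hf : f ∈ qwC n i j s) : f 0 = s := by
  unfold qwC at hf
  split_ifs at hf
  · obtain ⟨g, _, rfl⟩ := hf
    simp
  · simp at hf

lemma qw_split (n : ℕ) (i j : ℤ) : qwSet (n+1) i j =
    qwC n i j (1,1) ∪ (qwC n i j (-1,1) ∪ qwC n i j (1,-1)) := by
  ext f
  refine Fin.consCases (fun s g => ?_) f
  rw [qw_cons_mem]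
  have key : ∀ r, (Fin.cons s g : Fin (n+1) → ℤ × ℤ) ∈ qwC n i j r ↔
      s = r ∧ (0 ≤ i + r.1 ∧ 0 ≤ j + r.2) ∧ g ∈ qwSet n (i + r.1) (j + r.2) := by
    intro r
    unfold qwC
    split_ifs with h
    · simp only [Set.mem_image, Fin.cons_inj, h]
      constructor
      · rintro ⟨x, hx, rfl, rfl⟩
        exact ⟨rfl, by simp, hx⟩
      · rintro ⟨rfl, _, hx⟩
        exact ⟨g, hx, rfl, rfl⟩
    · simp [h]
  simp only [Set.mem_union, key, Finset.mem_insert, Finset.mem_singleton]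
  constructor
  · rintro ⟨⟨h1 | h1 | h1, h2⟩, h3⟩ <;> subst h1 <;> simp_all
  · rintro (⟨rfl, h⟩ | ⟨rfl, h⟩ | ⟨rfl, h⟩) <;> simp_all

lemma qw_card (n : ℕ) : ∀ i j : ℕ,
    ((qwSet n i j).ncard : ℂ) = (qwT^[n] (fun _ _ => 1)) i j := by
  induction n with
  | zero =>
    intro i j
    have : qwSet 0 i j = Set.univ := by
      ext f; simp [qwSet]
    rw [this]; simp
  | succ n ih =>
    intro i j
    have F := qwC_finite n i j
    rw [Function.iterate_succ_apply', qw_split,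
      Set.ncard_union_eq ?_ (F _) ((F _).union (F _)), Set.ncard_union_eq ?_ (F _) (F _)]
    rotate_left
    · rw [Set.disjoint_left]
      intro f h1 h2
      have := (qwC_zero _ _ _ _ _ h1).symm.trans (qwC_zero _ _ _ _ _ h2)
      simp at this
    · rw [Set.disjoint_left]
      rintro f h1 (h2 | h2) <;>
      · have := (qwC_zero _ _ _ _ _ h1).symm.trans (qwC_zero _ _ _ _ _ h2)
        simp at this
    simp only [qwC_ncard]
    have e1 : (0:ℤ) ≤ (i:ℤ) + 1 ∧ (0:ℤ) ≤ (j:ℤ) + 1 := by omega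
    rw [if_pos e1]
    have h1 := ih (i+1) (j+1)
    push_cast at h1 ⊢
    rw [h1]
    simp only [qwT, add_assoc]
    congr 1
    congr 1
    · rcases i with _ | i
      · simp
      · have e : (0:ℤ) ≤ ((i+1:ℕ):ℤ) + -1 ∧ (0:ℤ) ≤ (j:ℤ) + 1 := by omega
        have h := ih i (j+1)
        push_cast at h e ⊢
        rw [if_pos e]
        simp [← h]
    · rcases j with _ | j
      · simp
      · have e : (0:ℤ) ≤ (i:ℤ) + 1 ∧ (0:ℤ) ≤ ((j+1:ℕ):ℤ) + -1 := by omega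
        have h := ih (i+1) j
        push_cast at h e ⊢
        rw [if_pos e]
        simp [← h]

lemma qw_count (n : ℕ) :
    ((quarterPlaneWalks ({(-1,1),(1,1),(1,-1)} : Finset (ℤ × ℤ)) n : ℕ) : ℂ)
      = qwE n (fun _ _ => 1) := by
  rw [qwE, ← qw_card n 0 0]
  norm_cast
  rw [← Nat.card_coe_set_eq]
  unfold quarterPlaneWalks
  congr 1
  simp only [qwSet, zero_add]
  rfl

/-! ### Linear properties of the operator -/

lemma qwT_add (g h : ℕ → ℕ → ℂ) : qwT (g + h) = qwT g + qwT h := by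
  funext i j
  simp only [qwT, Pi.add_apply]
  split_ifs <;> ring

lemma qwT_smul (c : ℂ) (g : ℕ → ℕ → ℂ) : qwT (c • g) = c • qwT g := by
  funext i j
  simp only [qwT, Pi.smul_apply, smul_eq_mul]
  split_ifs <;> ring

lemma qwE_add (n : ℕ) : ∀ g h : ℕ → ℕ → ℂ, qwE n (g + h) = qwE n g + qwE n h := by
  induction n with
  | zero => intro g h; simp [qwE]
  | succ n ih =>
    intro g h
    have := ih (qwT g) (qwT h)
    simpa [qwE, Function.iterate_succ_apply, qwT_add] using this

lemma qwE_smul (n : ℕ) : ∀ (c : ℂ) (g : ℕ → ℕ → ℂ), qwE n (c • g) = c * qwE n g := by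
  induction n with
  | zero => intro c g; simp [qwE]
  | succ n ih =>
    intro c g
    have := ih c (qwT g)
    simpa [qwE, Function.iterate_succ_apply, qwT_smul] using this

lemma qwE_succ (n : ℕ) (g : ℕ → ℕ → ℂ) : qwE (n+1) g = qwE n (qwT g) := by
  simp [qwE, Function.iterate_succ_apply]

lemma qwE_swap (n : ℕ) : ∀ (g : ℕ → ℕ → ℂ), qwE n (fun i j => g j i) = qwE n g := by
  induction n with
  | zero => intro g; simp [qwE]
  | succ n ih =>
    intro g
    rw [qwE_succ, qwE_succ, ← ih (qwT g)]
    congr 1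
    funext i j
    simp only [qwT]
    ring

lemma qwT_bound (g : ℕ → ℕ → ℂ) (M : ℝ) (hM : 0 ≤ M) (h : ∀ i j, ‖g i j‖ ≤ M) :
    ∀ i j, ‖qwT g i j‖ ≤ 3 * M := by
  intro i j
  have h1 : ‖(if i = 0 then 0 else g (i-1) (j+1))‖ ≤ M := by
    split_ifs
    · simpa using hM
    · exact h _ _
  have h2 : ‖(if j = 0 then 0 else g (i+1) (j-1))‖ ≤ M := by
    split_ifs
    · simpa using hM
    · exact h _ _
  refine (norm_add₃_le).trans ?_
  linarith [h (i+1) (j+1)]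

lemma qwE_bound (n : ℕ) : ∀ (g : ℕ → ℕ → ℂ) (M : ℝ), 0 ≤ M → (∀ i j, ‖g i j‖ ≤ M) →
    ‖qwE n g‖ ≤ 3 ^ n * M := by
  induction n with
  | zero => intro g M _ h; simpa [qwE] using h 0 0
  | succ n ih =>
    intro g M hM h
    rw [qwE_succ]
    refine (ih (qwT g) (3 * M) (by positivity) (qwT_bound g M hM h)).trans (le_of_eq ?_)
    ring

/-- Boundary generating polynomial. -/
def qwR (n : ℕ) (x : ℂ) : ℂ := qwE n (fun i j => if i = 0 then x ^ j else 0)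

lemma qwR_bound (n : ℕ) (x : ℂ) (hx : ‖x‖ ≤ 1) : ‖qwR n x‖ ≤ 3 ^ n := by
  have := qwE_bound n (fun i j => if i = 0 then x ^ j else 0) 1 zero_le_one (by
    intro i j
    split_ifs
    · rw [norm_pow]; exact pow_le_one₀ (norm_nonneg _) hx
    · simp)
  simpa [qwR] using this

lemma qw_kernel (n : ℕ) (a b : ℂ) (ha : a ≠ 0) (hb : b ≠ 0) :
    qwE (n+1) (fun i j => a ^ i * b ^ j) =
      (a * b + b / a + a / b) * qwE n (fun i j => a ^ i * b ^ j)
        - b / a * qwR n b - a / b * qwR n a := by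
  have hs : qwR n a = qwE n (fun i j => if j = 0 then a ^ i else 0) := by
    exact (qwE_swap n (fun i j => if i = 0 then a ^ j else 0)).symm
  have : qwT (fun i j => a ^ i * b ^ j) =
      ((a * b + b / a + a / b) • ((fun i j => a ^ i * b ^ j) : ℕ → ℕ → ℂ))
        + ((-(b / a)) • ((fun i j => if i = 0 then b ^ j else 0) : ℕ → ℕ → ℂ)
          + (-(a / b)) • ((fun i j => if j = 0 then a ^ i else 0) : ℕ → ℕ → ℂ)) := by
    funext i j
    simp only [qwT, Pi.add_apply, Pi.smul_apply, smul_eq_mul]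
    rcases i with _ | i <;> rcases j with _ | j <;> simp <;> field_simp <;> ring
  rw [qwE_succ, this, qwE_add, qwE_add, qwE_smul, qwE_smul, qwE_smul, hs, qwR]
  ring

lemma qw_one_rec (n : ℕ) : qwE (n+1) (fun _ _ => 1) = 3 * qwE n (fun _ _ => 1) - 2 * qwR n 1 := by
  have := qw_kernel n 1 1 one_ne_zero one_ne_zero
  simp only [one_pow, mul_one, div_one] at this
  rw [this]; ring

/-- The boundary series. -/
noncomputable def qwRS (t x : ℂ) : ℂ := ∑' n, qwR n x * t ^ n

lemma qwRS_summable (t x : ℂ) (ht : ‖t‖ < 1/3) (hx : ‖x‖ ≤ 1) :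
    Summable (fun n => qwR n x * t ^ n) := by
  refine Summable.of_norm_bounded (g := fun n => (3 * ‖t‖) ^ n)
    (summable_geometric_of_lt_one (by positivity) (by linarith)) ?_
  intro n
  rw [norm_mul, norm_pow, mul_pow]
  gcongr
  exact qwR_bound n x hx

lemma qwA_summable (t : ℂ) (ht : ‖t‖ < 1/3) :
    Summable (fun n => qwE n (fun _ _ => 1) * t ^ n) := by
  refine Summable.of_norm_bounded (g := fun n => (3 * ‖t‖) ^ n)
    (summable_geometric_of_lt_one (by positivity) (by linarith)) ?_
  intro n
  rw [norm_mul, norm_pow, mul_pow]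
  gcongr
  simpa using qwE_bound n (fun _ _ => 1) 1 zero_le_one (by simp)

noncomputable def qwA (t : ℂ) : ℂ := ∑' n, qwE n (fun _ _ => 1) * t ^ n

lemma qwA_eq (t : ℂ) (ht : ‖t‖ < 1/3) : (1 - 3 * t) * qwA t = 1 - 2 * t * qwRS t 1 := by
  have hA := qwA_summable t ht
  have hR := qwRS_summable t 1 ht (by simp)
  have h0 : qwA t = 1 + ∑' n, qwE (n+1) (fun _ _ => 1) * t ^ (n+1) := by
    rw [qwA, hA.tsum_eq_zero_add]
    simp [qwE]
  have h1 : ∑' n, qwE (n+1) (fun _ _ => 1) * t ^ (n+1)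
      = 3 * t * qwA t - 2 * t * qwRS t 1 := by
    rw [qwA, qwRS, ← tsum_mul_left, ← tsum_mul_left,
      ← (hA.mul_left (3*t)).tsum_sub (hR.mul_left (2*t))]
    congr 1
    funext n
    rw [qw_one_rec]
    ring
  linear_combination h0 + h1

/-- The kernel method identity. -/
lemma qw_kernel_zero (t a b : ℂ) (ht : ‖t‖ < 1/3) (ha : a ≠ 0) (hb : b ≠ 0)
    (ha1 : ‖a‖ ≤ 1) (hb1 : ‖b‖ ≤ 1) (hK : t * (a * b + b / a + a / b) = 1) :
    t * b ^ 2 * qwRS t b + t * a ^ 2 * qwRS t a = a * b := by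
  have hRa := qwRS_summable t a ht ha1
  have hRb := qwRS_summable t b ht hb1
  set e : ℕ → ℂ := fun n => qwE n (fun i j => a ^ i * b ^ j) * t ^ n with he
  have hstep : ∀ n, e n - e (n+1) = t * (b / a) * (qwR n b * t ^ n)
      + t * (a / b) * (qwR n a * t ^ n) := by
    intro n
    simp only [he]
    rw [qw_kernel n a b ha hb]
    linear_combination (-qwE n (fun i j => a ^ i * b ^ j) * t ^ n) * hK
  have hlim : Filter.Tendsto e Filter.atTop (nhds 0) := by
    refine Summable.tendsto_atTop_zero ?_
    refine Summable.of_norm_bounded (g := fun n => (3 * ‖t‖) ^ n)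
      (summable_geometric_of_lt_one (by positivity) (by linarith)) ?_
    intro n
    rw [norm_mul, norm_pow, mul_pow]
    gcongr
    have := qwE_bound n (fun i j => a ^ i * b ^ j) 1 zero_le_one (by
      intro i j
      rw [norm_mul, norm_pow, norm_pow]
      exact mul_le_one₀ (pow_le_one₀ (norm_nonneg _) ha1) (by positivity)
        (pow_le_one₀ (norm_nonneg _) hb1))
    simpa using this
  have hsum : HasSum (fun n => e n - e (n+1)) (t * (b / a) * qwRS t b + t * (a / b) * qwRS t a) := by
    simp_rw [hstep]
    exact (hRb.hasSum.mul_left _).add (hRa.hasSum.mul_left _)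
  have h2 := hsum.tendsto_sum_nat
  have h3 : Filter.Tendsto (fun n => ∑ i ∈ Finset.range n, (e i - e (i+1))) Filter.atTop
      (nhds (1 - 0)) := by
    simp_rw [Finset.sum_range_sub']
    have e0 : e 0 = 1 := by simp [he, qwE]
    rw [e0]
    exact tendsto_const_nhds.sub hlim
  have h4 := tendsto_nhds_unique h2 h3
  field_simp at h4
  linear_combination h4

/-! ### The sequence of reciprocals of iterated kernel roots -/

noncomputable def quv (z : ℂ) : ℂ := 2 * z + z⁻¹

noncomputable def qut (z : ℂ) : ℂ := z / (1 + 2 * z ^ 2)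

noncomputable def qu (z : ℂ) : ℕ → ℂ
  | 0 => 1
  | 1 => z⁻¹
  | (n+2) => quv z * qu z (n+1) - qu z n

lemma qu_zero (z : ℂ) : qu z 0 = 1 := rfl
lemma qu_one (z : ℂ) : qu z 1 = z⁻¹ := rfl
lemma qu_rec (z : ℂ) (n : ℕ) : qu z (n+2) = quv z * qu z (n+1) - qu z n := rfl

lemma qu_inv (z : ℂ) (hz : z ≠ 0) (n : ℕ) :
    qu z n ^ 2 + qu z (n+1) ^ 2 + 1 = quv z * qu z n * qu z (n+1) := by
  induction n with
  | zero =>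
    simp only [qu_zero, zero_add, qu_one, quv]
    field_simp
    ring
  | succ n ih =>
    rw [qu_rec]
    linear_combination ih

lemma qu_small (z : ℂ) (hz : z ≠ 0) (h : ‖z‖ < 1/10) (n : ℕ) :
    0 < ‖qu z n‖ ∧ 8 * ‖qu z n‖ ≤ ‖qu z (n+1)‖ := by
  have hzp : 0 < ‖z‖ := norm_pos_iff.mpr hz
  have hi : 10 ≤ ‖z‖⁻¹ := by
    rw [le_inv_comm₀ (by norm_num) hzp]
    norm_num at h ⊢
    linarith
  have hv : 9 ≤ ‖quv z‖ := by
    have : ‖z⁻¹‖ ≤ ‖quv z‖ + ‖2 * z‖ := by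
      have e : z⁻¹ = quv z - 2 * z := by simp [quv]
      calc ‖z⁻¹‖ = ‖quv z - 2 * z‖ := by rw [← e]
        _ ≤ _ := norm_sub_le _ _
    rw [norm_inv, norm_mul] at this
    norm_num at this
    linarith
  induction n with
  | zero =>
    simp only [qu_zero, zero_add, qu_one, norm_inv, norm_one]
    constructor <;> linarith
  | succ n ih =>
    obtain ⟨ih1, ih2⟩ := ih
    refine ⟨by linarith, ?_⟩
    rw [qu_rec]
    have h1 := norm_sub_norm_le (quv z * qu z (n+1)) (qu z n)
    rw [norm_mul] at h1
    nlinarith [norm_nonneg (qu z (n+1))]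

lemma qu_small_ge (z : ℂ) (hz : z ≠ 0) (h : ‖z‖ < 1/10) (n : ℕ) : (8:ℝ) ^ n ≤ ‖qu z n‖ := by
  induction n with
  | zero => simp [qu_zero]
  | succ n ih =>
    have := (qu_small z hz h n).2
    rw [pow_succ]
    linarith

noncomputable def quTerm (n : ℕ) (z : ℂ) : ℂ := (-1) ^ n * (qu z n * qu z (n+1))⁻¹

noncomputable def quF (z : ℂ) : ℂ := ∑' n, quTerm n z

lemma one_add_ne (z : ℂ) (h : ‖z‖ < 1/10) : 1 + 2 * z ^ 2 ≠ 0 := by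
  intro h0
  have : ‖(1:ℂ)‖ = ‖2 * z ^ 2‖ := by
    rw [show (1:ℂ) = - (2 * z ^ 2) by linear_combination h0, norm_neg]
  rw [norm_mul, norm_pow] at this
  norm_num at this
  nlinarith [norm_nonneg z]

lemma qut_small (z : ℂ) (h : ‖z‖ < 1/10) : ‖qut z‖ < 1/3 := by
  have h1 : (98/100 : ℝ) ≤ ‖1 + 2 * z ^ 2‖ := by
    have := norm_sub_norm_le (1:ℂ) (-(2 * z ^ 2))
    rw [norm_neg, norm_mul, norm_pow, sub_neg_eq_add] at this
    norm_num at this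
    nlinarith [norm_nonneg z]
  rw [qut, norm_div, div_lt_iff₀ (by linarith)]
  linarith

lemma quF_eq (z : ℂ) (hz : z ≠ 0) (h : ‖z‖ < 1/10) : quF z = qut z * qwRS (qut z) 1 := by
  have hne : ∀ n, qu z n ≠ 0 := fun n => norm_pos_iff.mp (qu_small z hz h n).1
  have ht := qut_small z h
  have hd := one_add_ne z h
  have htv : qut z * quv z = 1 := by
    rw [qut, quv, div_mul_eq_mul_div, div_eq_one_iff_eq hd]
    field_simp
    ring
  have hy : ∀ n, ‖(qu z n)⁻¹‖ ≤ (1/8:ℝ) ^ n := by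
    intro n
    rw [norm_inv, one_div, inv_pow]
    exact inv_anti₀ (by positivity) (qu_small_ge z hz h n)
  have hy1 : ∀ n, ‖(qu z n)⁻¹‖ ≤ 1 := fun n =>
    (hy n).trans (pow_le_one₀ (by norm_num) (by norm_num))
  have hker : ∀ n, qut z * (qu z (n+1))⁻¹ ^ 2 * qwRS (qut z) (qu z (n+1))⁻¹
      + qut z * (qu z n)⁻¹ ^ 2 * qwRS (qut z) (qu z n)⁻¹ = (qu z n)⁻¹ * (qu z (n+1))⁻¹ := by
    intro n
    apply qw_kernel_zero _ _ _ ht (inv_ne_zero (hne n)) (inv_ne_zero (hne (n+1))) (hy1 _) (hy1 _)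
    have h1 := hne n
    have h2 := hne (n+1)
    have h3 := qu_inv z hz n
    field_simp
    linear_combination qut z * h3 + qu z n * qu z (n+1) * htv
  set G : ℕ → ℂ := fun n => qut z * (qu z n)⁻¹ ^ 2 * qwRS (qut z) (qu z n)⁻¹ with hG
  have hRb : ∀ x : ℂ, ‖x‖ ≤ 1 → ‖qwRS (qut z) x‖ ≤ (1 - 3 * ‖qut z‖)⁻¹ := by
    intro x hx
    rw [qwRS]
    refine tsum_of_norm_bounded (hasSum_geometric_of_lt_one (by positivity) (by linarith)) ?_
    intro n
    rw [norm_mul, norm_pow, mul_pow]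
    gcongr
    exact qwR_bound n x hx
  have hGlim : Filter.Tendsto G Filter.atTop (nhds 0) := by
    have hb : ∀ n, ‖G n‖ ≤ (1/8:ℝ) ^ n * (1 - 3 * ‖qut z‖)⁻¹ := by
      intro n
      simp only [hG]
      rw [norm_mul, norm_mul, norm_pow]
      have h1 := hRb _ (hy1 n)
      have h2 : ‖qut z‖ * ‖(qu z n)⁻¹‖ ^ 2 ≤ (1/8:ℝ)^n := by
        have := hy n
        have := hy1 n
        have := norm_nonneg (qu z n)⁻¹
        have := norm_nonneg (qut z)
        calc ‖qut z‖ * ‖(qu z n)⁻¹‖ ^ 2 ≤ 1 * (1 * ‖(qu z n)⁻¹‖) := by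
              rw [pow_two]; gcongr; linarith
          _ ≤ _ := by linarith
      gcongr
    refine squeeze_zero_norm hb ?_
    have := (tendsto_pow_atTop_nhds_zero_of_lt_one (r := (1/8:ℝ)) (by norm_num)
      (by norm_num)).mul_const ((1 - 3 * ‖qut z‖)⁻¹)
    simpa using this
  have hterm : ∀ n, quTerm n z = (-1) ^ n * G n - (-1) ^ (n+1) * G (n+1) := by
    intro n
    have := hker n
    rw [quTerm, mul_inv]
    simp only [hG]
    rw [← this]
    ring
  have hsum : Summable (fun n => quTerm n z) := by
    refine Summable.of_norm_bounded (g := fun n => (1/8:ℝ) ^ n)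
      (summable_geometric_of_lt_one (by norm_num) (by norm_num)) ?_
    intro n
    rw [quTerm, mul_inv, norm_mul, norm_mul, norm_pow]
    simp only [norm_neg, norm_one, one_pow, one_mul]
    calc _ ≤ (1/8:ℝ)^n * 1 := by
          gcongr
          · exact hy n
          · exact hy1 _
      _ = _ := mul_one _
  have h2 := hsum.hasSum.tendsto_sum_nat
  have h3 : Filter.Tendsto (fun n => ∑ i ∈ Finset.range n, quTerm i z) Filter.atTop
      (nhds (G 0 - 0)) := by
    simp_rw [hterm]
    simp_rw [Finset.sum_range_sub' (fun n => (-1) ^ n * G n)]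
    simp only [pow_zero, one_mul]
    refine tendsto_const_nhds.sub ?_
    rw [tendsto_zero_iff_norm_tendsto_zero] at hGlim ⊢
    simpa using hGlim
  have h4 := tendsto_nhds_unique h2 h3
  rw [quF, h4]
  simp [hG, qu_zero]

lemma quF_A (z : ℂ) (hz : z ≠ 0) (h : ‖z‖ < 1/10) :
    (1 - 3 * qut z) * qwA (qut z) = 1 - 2 * quF z := by
  rw [qwA_eq _ (qut_small z h), quF_eq z hz h]
  ring

/-! ### Growth away from the cut -/

def quGood (z : ℂ) : Prop := z ≠ 0 ∧ ∃ l : ℂ, 1 < ‖l‖ ∧ quv z = l + l⁻¹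

lemma quGood_of (z : ℂ) (hz : z ≠ 0) (h : ∀ x : ℝ, |x| ≤ 2 → quv z ≠ x) : quGood z := by
  refine ⟨hz, ?_⟩
  obtain ⟨s, hs⟩ := IsAlgClosed.exists_pow_nat_eq ((quv z) ^ 2 - 4) (n := 2) (by norm_num)
  set l : ℂ := (quv z + s) / 2 with hl
  have hq : l * (quv z - l) = 1 := by
    rw [hl]; linear_combination (-1/4) * hs
  have hl0 : l ≠ 0 := by
    intro h0; simp [h0] at hq
  have hv : quv z = l + l⁻¹ := by
    field_simp; linear_combination hq
  rcases lt_trichotomy 1 ‖l‖ with h1 | h1 | h1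
  · exact ⟨l, h1, hv⟩
  · exfalso
    apply h (2 * l.re)
    · rw [abs_mul]
      have := Complex.abs_re_le_norm l
      rw [← h1] at this
      norm_num
      linarith
    · rw [hv]
      have : l⁻¹ = (starRingEnd ℂ) l := by
        rw [Complex.inv_def, Complex.normSq_eq_norm_sq, ← h1]; simp
      rw [this, Complex.add_conj]
  · refine ⟨l⁻¹, ?_, by rw [hv, inv_inv, add_comm]⟩
    rw [norm_inv]
    exact (one_lt_inv₀ (norm_pos_iff.mpr hl0)).mpr h1

lemma quGood_of' (z : ℂ) (hz : z ≠ 0) (h : Complex.normSq z ≠ 1/2 ∨ z.im = 0) : quGood z := by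
  apply quGood_of z hz
  intro x hx hv
  have h1 : 2 * z * z + 1 = x * z := by
    rw [quv] at hv
    field_simp at hv
    linear_combination hv
  have hre := congrArg Complex.re h1
  have him := congrArg Complex.im h1
  simp at hre him
  rw [abs_le] at hx
  by_cases hb : z.im = 0
  · rw [hb] at hre
    nlinarith [sq_nonneg (z.re - 1/2), sq_nonneg (z.re + 1/2)]
  · have hx4 : x = 4 * z.re := by
      apply mul_right_cancel₀ hb
      linear_combination -him
    rcases h with h | h
    · apply h
      rw [Complex.normSq_apply]
      rw [hx4] at hre
      linear_combination (-1/2) * hre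
    · exact hb h

section
variable {z l : ℂ}

lemma qu_sub_l (hl : l ≠ 0) (hv : quv z = l + l⁻¹) (n : ℕ) :
    qu z (n+1) - l * qu z n = (z⁻¹ - l) * l⁻¹ ^ n := by
  induction n with
  | zero => simp [qu_zero, qu_one]
  | succ n ih =>
    rw [qu_rec, hv, pow_succ]
    have : l⁻¹ * l = 1 := inv_mul_cancel₀ hl
    linear_combination l⁻¹ * ih + qu z n * this

lemma qu_sub_m (hl : l ≠ 0) (hv : quv z = l + l⁻¹) (n : ℕ) :
    qu z (n+1) - l⁻¹ * qu z n = (z⁻¹ - l⁻¹) * l ^ n := by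
  have := qu_sub_l (z := z) (l := l⁻¹) (inv_ne_zero hl) (by rw [hv, inv_inv, add_comm]) n
  simpa using this

lemma qu_explicit (hl : l ≠ 0) (hv : quv z = l + l⁻¹) (n : ℕ) :
    (l - l⁻¹) * qu z n = (z⁻¹ - l⁻¹) * l ^ n - (z⁻¹ - l) * l⁻¹ ^ n := by
  linear_combination qu_sub_m hl hv n - qu_sub_l hl hv n

lemma qu_a_ne (_hz : z ≠ 0) (hl : l ≠ 0) (hv : quv z = l + l⁻¹) : z⁻¹ - l⁻¹ ≠ 0 := by
  intro h
  have h1 : z = l := by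
    rw [sub_eq_zero] at h
    exact inv_injective h
  subst h1
  rw [quv] at hv
  apply hl
  linear_combination hv

lemma qu_zero_unique (hz : z ≠ 0) (hl : 1 < ‖l‖) (hv : quv z = l + l⁻¹) {m k : ℕ}
    (hm : qu z m = 0) (hk : qu z k = 0) : m = k := by
  have hl0 : l ≠ 0 := by rintro rfl; simp at hl; linarith
  have ha := qu_a_ne hz hl0 hv
  have key : ∀ n, qu z n = 0 → (z⁻¹ - l⁻¹) * (l ^ 2) ^ n = z⁻¹ - l := by
    intro n hn
    have h1 := qu_explicit hl0 hv n
    rw [hn, mul_zero, inv_pow] at h1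
    have h2 : l ^ n ≠ 0 := pow_ne_zero _ hl0
    rw [← pow_mul, mul_comm 2 n, pow_mul]
    have h3 : (l^n)⁻¹ * l ^ n = 1 := inv_mul_cancel₀ h2
    linear_combination (-l ^ n) * h1 + (z⁻¹ - l) * h3
  have h1 := (key m hm).trans (key k hk).symm
  have h2 := mul_left_cancel₀ ha h1
  have h3 := congrArg norm h2
  rw [norm_pow (l^2) m, norm_pow (l^2) k] at h3
  have h4 : 1 < ‖l ^ 2‖ := by rw [norm_pow]; exact one_lt_pow₀ hl (by norm_num)
  exact pow_right_injective₀ (by linarith) h4.ne' h3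

lemma qu_analyticAt (hz : z ≠ 0) (n : ℕ) : AnalyticAt ℂ (fun w => qu w n) z ∧
    AnalyticAt ℂ (fun w => qu w (n+1)) z := by
  induction n with
  | zero =>
    refine ⟨analyticAt_const, ?_⟩
    simp only [zero_add, qu_one]
    exact analyticAt_id.inv hz
  | succ n ih =>
    refine ⟨ih.2, ?_⟩
    simp only [qu_rec]
    refine AnalyticAt.sub (AnalyticAt.mul ?_ ih.2) ih.1
    unfold quv
    exact (analyticAt_const.mul analyticAt_id).add (analyticAt_id.inv hz)

lemma qu_growth (hz : z ≠ 0) (hl : 1 < ‖l‖) (hv : quv z = l + l⁻¹) (N₀ : ℕ) :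
    ∃ N, N₀ ≤ N ∧ ∃ r c : ℝ, 1 < r ∧ 0 < c ∧
      ∀ᶠ w in nhds z, ∀ n, c * r ^ n ≤ ‖qu w (N+n)‖ := by
  have hl0 : l ≠ 0 := by rintro rfl; simp at hl; linarith
  have ha := qu_a_ne hz hl0 hv
  set L := ‖l‖ with hL
  set d := (L-1)/2 with hd
  set r := (L+1)/2 with hr
  have hdpos : 0 < d := by rw [hd]; linarith
  have hr1 : 1 < r := by rw [hr]; linarith
  have hLd : L - d = r := by rw [hd, hr]; ring
  have hlm : l - l⁻¹ ≠ 0 := by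
    intro h
    have h1 : l = l⁻¹ := sub_eq_zero.mp h
    have h2 := congrArg norm h1
    rw [norm_inv, ← hL] at h2
    have := inv_lt_one_of_one_lt₀ hl
    linarith
  -- base inequality at z for large N
  have hbase : ∃ N, N₀ ≤ N ∧ ‖qu z (N+1) - l * qu z N‖ < d * ‖qu z N‖ := by
    set B := ‖z⁻¹ - l‖ with hB
    have hp : 0 < ‖z⁻¹ - l⁻¹‖ := norm_pos_iff.mpr ha
    have htend := (tendsto_pow_atTop_atTop_of_one_lt hl).const_mul_atTop hp
    have hev := (htend.eventually_gt_atTop (B + ‖l - l⁻¹‖ * B / d)).and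
      (Filter.eventually_ge_atTop N₀)
    obtain ⟨N, hN, hN0⟩ := hev.exists
    refine ⟨N, hN0, ?_⟩
    have hs : ‖qu z (N+1) - l * qu z N‖ ≤ B := by
      rw [qu_sub_l hl0 hv, norm_mul, norm_pow, norm_inv, ← hL]
      have : L⁻¹ ^ N ≤ 1 := pow_le_one₀ (by positivity) (inv_le_one_of_one_le₀ hl.le)
      nlinarith [norm_nonneg (z⁻¹ - l)]
    have hb : ‖(z⁻¹ - l) * l⁻¹ ^ N‖ ≤ B := by rw [← qu_sub_l hl0 hv]; exact hs
    have hge : ‖z⁻¹ - l⁻¹‖ * L ^ N - B ≤ ‖l - l⁻¹‖ * ‖qu z N‖ := by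
      rw [← norm_mul, qu_explicit hl0 hv]
      have := norm_sub_norm_le ((z⁻¹ - l⁻¹) * l ^ N) ((z⁻¹ - l) * l⁻¹ ^ N)
      rw [norm_mul, norm_pow] at this
      linarith
    have hlmp : 0 < ‖l - l⁻¹‖ := norm_pos_iff.mpr hlm
    have : ‖l - l⁻¹‖ * B / d < ‖l - l⁻¹‖ * ‖qu z N‖ := by linarith
    rw [mul_div_assoc] at this
    have := lt_of_mul_lt_mul_left this hlmp.le
    rw [div_lt_iff₀ hdpos] at this
    linarith
  obtain ⟨N, hN0, hN⟩ := hbase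
  have hc1 : ContinuousAt (fun w => qu w N) z := (qu_analyticAt hz N).1.continuousAt
  have hc2 : ContinuousAt (fun w => qu w (N+1)) z := (qu_analyticAt hz N).2.continuousAt
  have hcv : ContinuousAt quv z := by
    unfold quv
    exact (continuousAt_const.mul continuousAt_id).add (continuousAt_id.inv₀ hz)
  have hqpos : 0 < ‖qu z N‖ := by
    have := norm_nonneg (qu z (N+1) - l * qu z N)
    by_contra h
    have h0 : ‖qu z N‖ = 0 := le_antisymm (not_lt.mp h) (norm_nonneg _)
    rw [h0] at hN
    linarith
  set e := d - L⁻¹ * d * r⁻¹ with he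
  have hepos : 0 < e := by
    have h1 : L⁻¹ < 1 := inv_lt_one_of_one_lt₀ hl
    have h2 : r⁻¹ < 1 := inv_lt_one_of_one_lt₀ hr1
    have h3 : 0 < r⁻¹ := by positivity
    have h4 : 0 < L⁻¹ := by positivity
    have : L⁻¹ * r⁻¹ < 1 := by nlinarith
    rw [he]
    nlinarith
  refine ⟨N, hN0, r, ‖qu z N‖ / 2, hr1, by linarith, ?_⟩
  have ev1 : ∀ᶠ w in nhds z, ‖qu w (N+1) - l * qu w N‖ < d * ‖qu w N‖ :=
    ((hc2.sub (continuousAt_const.mul hc1)).norm).eventually_lt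
      (continuousAt_const.mul hc1.norm) hN
  have ev2 : ∀ᶠ w in nhds z, ‖qu z N‖ / 2 < ‖qu w N‖ :=
    continuousAt_const.eventually_lt hc1.norm (by linarith)
  have ev3 : ∀ᶠ w in nhds z, ‖quv w - quv z‖ < e :=
    ((hcv.sub continuousAt_const).norm).eventually_lt continuousAt_const (by simpa using hepos)
  filter_upwards [ev1, ev2, ev3] with w h1 h2 h3
  have main : ∀ n, ‖qu w (N+n+1) - l * qu w (N+n)‖ ≤ d * ‖qu w (N+n)‖ ∧
      ‖qu z N‖ / 2 * r ^ n ≤ ‖qu w (N+n)‖ := by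
    intro n
    induction n with
    | zero => exact ⟨h1.le, by simpa using h2.le⟩
    | succ n ih =>
      obtain ⟨i1, i2⟩ := ih
      have hgr : r * ‖qu w (N+n)‖ ≤ ‖qu w (N+n+1)‖ := by
        have := norm_sub_norm_le (l * qu w (N+n)) (l * qu w (N+n) - qu w (N+n+1))
        rw [sub_sub_cancel, norm_mul, norm_sub_rev, ← hL] at this
        rw [← hLd]
        rw [norm_sub_rev] at i1
        rw [norm_sub_rev (qu w (N+n+1))] at this
        linarith
      refine ⟨?_, ?_⟩
      · have e1 : qu w (N+(n+1)+1) - l * qu w (N+(n+1)) =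
            (quv w - quv z) * qu w (N+n+1) + l⁻¹ * (qu w (N+n+1) - l * qu w (N+n)) := by
          rw [show N + (n+1) + 1 = (N+n) + 2 by ring, show N + (n+1) = N+n+1 by ring, qu_rec, hv]
          have : l⁻¹ * l = 1 := inv_mul_cancel₀ hl0
          linear_combination (qu w (N+n)) * this
        rw [e1]
        refine (norm_add_le _ _).trans ?_
        rw [norm_mul, norm_mul, norm_inv, ← hL, show N + (n+1) = N+n+1 by ring]
        have hrp : 0 < r := by linarith
        have hq : ‖qu w (N+n)‖ ≤ r⁻¹ * ‖qu w (N+n+1)‖ := by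
          rw [le_inv_mul_iff₀ hrp]; exact hgr
        have a1 : ‖quv w - quv z‖ * ‖qu w (N+n+1)‖ ≤ e * ‖qu w (N+n+1)‖ := by gcongr
        have a2 : L⁻¹ * ‖qu w (N+n+1) - l * qu w (N+n)‖ ≤
            L⁻¹ * (d * (r⁻¹ * ‖qu w (N+n+1)‖)) := by
          gcongr
          exact i1.trans (by gcongr)
        have : d = e + L⁻¹ * d * r⁻¹ := by rw [he]; ring
        calc _ ≤ _ := add_le_add a1 a2
          _ = (e + L⁻¹ * d * r⁻¹) * ‖qu w (N+n+1)‖ := by ring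
          _ = _ := by rw [← this]
      · rw [pow_succ, show N + (n+1) = N+n+1 by ring]
        have : 0 < r := by linarith
        nlinarith
  exact fun n => (main n).2

end

/-! ### Zeros of `qu` -/

def quS (x : ℝ) : ℕ → ℝ
  | 0 => 0
  | 1 => 1
  | (n+2) => x * quS x (n+1) - quS x n

lemma quS_inv (x : ℝ) (n : ℕ) :
    quS x (n+1) ^ 2 - x * quS x (n+1) * quS x n + quS x n ^ 2 = 1 := by
  induction n with
  | zero => simp [quS]
  | succ n ih =>
    rw [show quS x (n+1+1) = x * quS x (n+1) - quS x n from rfl]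
    linear_combination ih

lemma qu_eq_S (z : ℂ) (x : ℝ) (hv : quv z = x) (n : ℕ) :
    qu z (n+1) = quS x (n+1) * z⁻¹ - quS x n ∧
    qu z (n+2) = quS x (n+2) * z⁻¹ - quS x (n+1) := by
  induction n with
  | zero => simp [quS, qu_rec, qu_one, qu_zero, hv]
  | succ n ih =>
    refine ⟨ih.2, ?_⟩
    rw [qu_rec, hv, ih.1, ih.2,
      show quS x (n+1+2) = x * quS x (n+2) - quS x (n+1) from rfl,
      show quS x (n+1+1) = x * quS x (n+1) - quS x n from rfl]
    push_cast
    ring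

lemma qu_zero_nonreal (z : ℂ) (hz : z ≠ 0) (m : ℕ) (h : qu z m = 0) (x : ℝ) : quv z ≠ x := by
  intro hv
  rcases m with _ | n
  · simp [qu_zero] at h
  have h1 := (qu_eq_S z x hv n).1
  have h2 : ((quS x (n+1) : ℂ)) ^ 2 - x * quS x (n+1) * quS x n + quS x n ^ 2 = 1 := by
    exact_mod_cast quS_inv x n
  have h3 : (2 * z + z⁻¹) = x := hv
  have h4 : z⁻¹ * z = 1 := inv_mul_cancel₀ hz
  have h5 : (quS x (n+1) : ℂ) ^ 2 + 1 = 0 := by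
    rw [h] at h1
    linear_combination (-(quS x (n+1) * (2 * z) - quS x n : ℂ)) * h1 - h2
      + ((quS x (n+1) : ℂ) * quS x n) * h3 + (-2 * (quS x (n+1) : ℂ) ^ 2) * h4
  have h6 : quS x (n+1) ^ 2 + 1 = 0 := by exact_mod_cast h5
  nlinarith [sq_nonneg (quS x (n+1))]

lemma qu_zero_normSq (z : ℂ) (hz : z ≠ 0) (m : ℕ) (h : qu z m = 0) : Complex.normSq z ≠ 1/2 := by
  intro hn
  apply qu_zero_nonreal z hz m h (4 * z.re)
  rw [quv, Complex.inv_def, hn]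
  have := Complex.add_conj z
  push_cast at this ⊢
  linear_combination 2 * this

open Polynomial in
noncomputable def quP : ℕ → ℂ[X]
  | 0 => 1
  | 1 => 1
  | (n+2) => (2 * X ^ 2 + 1) * quP (n+1) - X ^ 2 * quP n

open Polynomial in
lemma quP_rec (n : ℕ) : quP (n+2) = (2 * X ^ 2 + 1) * quP (n+1) - X ^ 2 * quP n := rfl

lemma quP_eval (z : ℂ) (hz : z ≠ 0) (n : ℕ) : (quP n).eval z = z ^ n * qu z n ∧
    (quP (n+1)).eval z = z ^ (n+1) * qu z (n+1) := by
  induction n with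
  | zero => simp [quP, qu_zero, qu_one, hz]
  | succ n ih =>
    refine ⟨ih.2, ?_⟩
    rw [quP_rec, qu_rec, quv]
    simp only [Polynomial.eval_sub, Polynomial.eval_mul, Polynomial.eval_add, Polynomial.eval_pow,
      Polynomial.eval_X, Polynomial.eval_ofNat, Polynomial.eval_one, ih.1, ih.2]
    field_simp
    ring

lemma quP_eval_zero (n : ℕ) : (quP n).eval 0 = 1 ∧ (quP (n+1)).eval 0 = 1 := by
  induction n with
  | zero => simp [quP]
  | succ n ih =>
    refine ⟨ih.2, ?_⟩
    rw [quP_rec]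
    simp [ih.2]

lemma quP_ne_zero (n : ℕ) : quP n ≠ 0 := by
  intro h
  have := (quP_eval_zero n).1
  simp [h] at this

open Polynomial in
lemma quP_natDegree (n : ℕ) : (quP (n+1)).natDegree = 2 * n ∧
    (quP (n+2)).natDegree = 2 * n + 2 := by
  have h2 : (2 * X ^ 2 + 1 : ℂ[X]).natDegree = 2 := by compute_degree!
  have h20 : (2 * X ^ 2 + 1 : ℂ[X]) ≠ 0 := by
    intro h; rw [h] at h2; simp at h2
  induction n with
  | zero =>
    refine ⟨by simp [quP], ?_⟩
    have : quP (0+2) = X ^ 2 + 1 := by simp [quP]; ring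
    rw [this]
    compute_degree!
  | succ n ih =>
    refine ⟨ih.2, ?_⟩
    rw [quP_rec]
    have e1 : ((2 * X ^ 2 + 1) * quP (n+1+1)).natDegree = 2 * n + 4 := by
      rw [natDegree_mul h20 (quP_ne_zero _), h2, ih.2]; ring
    have e2 : (X ^ 2 * quP (n+1)).natDegree = 2 * n + 2 := by
      rw [natDegree_mul (by simp) (quP_ne_zero _), ih.1, natDegree_X_pow]; ring
    rw [natDegree_sub_eq_left_of_natDegree_lt (by rw [e1, e2]; omega), e1]
    ring

lemma qu_exists_zero (n : ℕ) : ∃ z, z ≠ 0 ∧ qu z (n+2) = 0 := by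
  have hd : (quP (n+2)).degree ≠ 0 := by
    rw [Polynomial.degree_eq_natDegree (quP_ne_zero _), (quP_natDegree n).2]
    norm_cast
  obtain ⟨z, hz⟩ := IsAlgClosed.exists_root _ hd
  have hz0 : z ≠ 0 := by
    rintro rfl
    rw [Polynomial.IsRoot, (quP_eval_zero _).1] at hz
    exact one_ne_zero hz
  refine ⟨z, hz0, ?_⟩
  rw [Polynomial.IsRoot, (quP_eval z hz0 _).1] at hz
  exact (mul_eq_zero.mp hz).resolve_left (pow_ne_zero _ hz0)

lemma qu_eventually_ne (z : ℂ) (hz : z ≠ 0) (n : ℕ) :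
    ∀ᶠ w in nhdsWithin z {z}ᶜ, qu w n ≠ 0 := by
  have hfin : Set.Finite {w | (quP n).eval w = 0} := by
    refine Set.Finite.subset (quP n).roots.toFinset.finite_toSet ?_
    intro w hw
    simpa [quP_ne_zero] using hw
  have h1 : ∀ᶠ w in nhdsWithin z {z}ᶜ, w ∉ {w | (quP n).eval w = 0} := by
    have : ({w | (quP n).eval w = 0} \ {z})ᶜ ∈ nhds z := by
      apply (hfin.subset Set.sdiff_subset).isClosed.isOpen_compl.mem_nhds
      simp
    filter_upwards [nhdsWithin_le_nhds this, self_mem_nhdsWithin] with w hw hw2 hw3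
    exact hw ⟨hw3, hw2⟩
  filter_upwards [h1, nhdsWithin_le_nhds (isOpen_ne.mem_nhds hz)] with w hw hw0 hw1
  apply hw
  rw [(quP_eval w hw0 n).1, hw1, mul_zero]

/-! ### Meromorphy of `quF` -/

lemma quTerm_meromorphicAt (z : ℂ) (hz : z ≠ 0) (n : ℕ) : MeromorphicAt (quTerm n) z := by
  have h1 := (qu_analyticAt hz n).1.meromorphicAt
  have h2 := (qu_analyticAt hz n).2.meromorphicAt
  exact (MeromorphicAt.const _ _).mul (h1.mul h2).inv

lemma quTerm_analyticAt (z : ℂ) (hz : z ≠ 0) (n : ℕ) (h1 : qu z n ≠ 0) (h2 : qu z (n+1) ≠ 0) :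
    AnalyticAt ℂ (quTerm n) z :=
  analyticAt_const.mul (((qu_analyticAt hz n).1.mul (qu_analyticAt hz n).2).inv (mul_ne_zero h1 h2))

lemma quF_local (z : ℂ) (h : quGood z) (N₀ : ℕ) : ∃ N, N₀ ≤ N ∧ ∃ T : ℂ → ℂ, AnalyticAt ℂ T z ∧
    ∀ᶠ w in nhds z, quF w = ∑ n ∈ Finset.range N, quTerm n w + T w := by
  obtain ⟨hz, l, hl, hv⟩ := h
  obtain ⟨N, hN, r, c, hr, hc, hev⟩ := qu_growth hz hl hv N₀
  refine ⟨N, hN, fun w => ∑' n, quTerm (n+N) w, ?_⟩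
  have hev0 : ∀ᶠ w in nhds z, w ≠ 0 := isOpen_ne.mem_nhds hz
  obtain ⟨U, hU, hUo, hzU⟩ := eventually_nhds_iff.mp (hev.and hev0)
  have hb : ∀ n w, w ∈ U → ‖quTerm (n+N) w‖ ≤ (c^2)⁻¹ * r⁻¹ ^ n := by
    intro n w hw
    have g1 := (hU w hw).1 n
    have g2 := (hU w hw).1 (n+1)
    rw [quTerm, norm_mul, norm_pow, norm_neg, norm_one, one_pow, one_mul, norm_inv, norm_mul,
      inv_pow, ← mul_inv]
    have hrn : 1 ≤ r ^ n := one_le_pow₀ hr.le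
    apply inv_anti₀ (by positivity)
    rw [add_comm n N, show N + n + 1 = N + (n+1) by ring]
    calc c^2 * r^n ≤ (c * r^n) * (c * r^(n+1)) := by
          have : 1 ≤ r ^ (n+1) := one_le_pow₀ hr.le
          have h3 : 0 < c^2 * r^n := by positivity
          calc c^2 * r^n = c^2 * r^n * 1 := by ring
            _ ≤ c^2 * r^n * r^(n+1) := by gcongr
            _ = _ := by ring
      _ ≤ _ := by gcongr
  have hsum : Summable (fun n : ℕ => (c^2)⁻¹ * r⁻¹ ^ n) :=
    (summable_geometric_of_lt_one (by positivity) (inv_lt_one_of_one_lt₀ hr)).mul_left _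
  have hne : ∀ n w, w ∈ U → qu w (n+N) ≠ 0 := by
    intro n w hw h0
    have g1 := (hU w hw).1 n
    rw [add_comm, h0, norm_zero] at g1
    have : 0 < c * r ^ n := by positivity
    linarith
  have hdiff : DifferentiableOn ℂ (fun w => ∑' n, quTerm (n+N) w) U := by
    refine Complex.differentiableOn_tsum_of_summable_norm hsum ?_ hUo hb
    intro n w hw
    refine (quTerm_analyticAt w (hU w hw).2 _ (hne n w hw) ?_).differentiableAt.differentiableWithinAt
    have := hne (n+1) w hw
    rwa [show n + 1 + N = n + N + 1 by ring] at this
  refine ⟨hdiff.analyticAt (hUo.mem_nhds hzU), ?_⟩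
  filter_upwards [hUo.mem_nhds hzU] with w hw
  have hs : Summable (fun n => quTerm (n+N) w) :=
    Summable.of_norm_bounded hsum (fun n => hb n w hw)
  have hs' : Summable (fun n => quTerm n w) :=
    (summable_nat_add_iff (f := fun n => quTerm n w) N).mp hs
  have he := hs'.sum_add_tsum_nat_add N
  exact he.symm

lemma quF_meromorphicAt (z : ℂ) (h : quGood z) : MeromorphicAt quF z := by
  obtain ⟨N, -, T, hT, hev⟩ := quF_local z h 0
  have : MeromorphicAt (fun w => ∑ n ∈ Finset.range N, quTerm n w + T w) z := by
    refine MeromorphicAt.add ?_ hT.meromorphicAt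
    exact MeromorphicAt.fun_sum (fun n _ => quTerm_meromorphicAt z h.1 n)
  refine this.congr ?_
  filter_upwards [nhdsWithin_le_nhds hev] with w hw using hw.symm

lemma quF_order (z : ℂ) (h : quGood z) (k : ℕ) (hk : qu z (k+1) = 0) :
    meromorphicOrderAt quF z < 0 := by
  obtain ⟨N, hN, T, hT, hev⟩ := quF_local z h (k+2)
  obtain ⟨hz, l, hl, hv⟩ := h
  have huniq : ∀ n, n ≠ k+1 → qu z n ≠ 0 := fun n hn h0 => hn (qu_zero_unique hz hl hv h0 hk)
  set H : ℂ → ℂ := fun w => (-1)^k * ((qu w k)⁻¹ - (qu w (k+2))⁻¹) with hH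
  have hHa : AnalyticAt ℂ H z := by
    refine analyticAt_const.mul (AnalyticAt.sub ?_ ?_)
    · exact (qu_analyticAt hz k).1.inv (huniq k (by omega))
    · exact (qu_analyticAt hz (k+2)).1.inv (huniq (k+2) (by omega))
  have hH0 : H z ≠ 0 := by
    simp only [hH]
    have e : qu z (k+2) = - qu z k := by rw [qu_rec, hk]; ring
    have e0 := huniq k (by omega)
    rw [e, inv_neg, sub_neg_eq_add, ← two_mul]
    refine mul_ne_zero (pow_ne_zero _ (by norm_num)) (mul_ne_zero two_ne_zero (inv_ne_zero e0))
  set R : ℂ → ℂ := fun w => ∑ n ∈ ((Finset.range N).erase k).erase (k+1), quTerm n w + T w with hR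
  have hRa : AnalyticAt ℂ R z := by
    refine AnalyticAt.add ?_ hT
    refine Finset.analyticAt_fun_sum _ (fun n hn => ?_)
    simp only [Finset.mem_erase] at hn
    exact quTerm_analyticAt z hz n (huniq n hn.1) (huniq (n+1) (by omega))
  have hFe : quF =ᶠ[nhdsWithin z {z}ᶜ] (H * (fun w => qu w (k+1))⁻¹) + R := by
    filter_upwards [nhdsWithin_le_nhds hev] with w hw
    rw [hw, ← Finset.add_sum_erase (Finset.range N) _ (a := k) (by simp; omega),
      ← Finset.add_sum_erase ((Finset.range N).erase k) _ (a := k+1) (by simp; omega)]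
    simp only [Pi.add_apply, Pi.mul_apply, Pi.inv_apply, hH, hR, quTerm, mul_inv]
    ring
  have hu := (qu_analyticAt hz k).2
  have hpos : 0 < meromorphicOrderAt (fun w => qu w (k+1)) z := by
    rw [← tendsto_zero_iff_meromorphicOrderAt_pos hu.meromorphicAt]
    have := hu.continuousAt.tendsto
    rw [hk] at this
    exact this.mono_left nhdsWithin_le_nhds
  have hnt : meromorphicOrderAt (fun w => qu w (k+1)) z ≠ ⊤ :=
    (meromorphicOrderAt_ne_top_iff_eventually_ne_zero hu.meromorphicAt).mpr
      (qu_eventually_ne z hz (k+1))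
  have h1 : meromorphicOrderAt (H * (fun w => qu w (k+1))⁻¹) z < 0 := by
    rw [meromorphicOrderAt_mul_of_ne_zero hHa hH0, meromorphicOrderAt_inv]
    obtain ⟨m, hm⟩ := WithTop.ne_top_iff_exists.mp hnt
    rw [← hm] at hpos ⊢
    have : (0:ℤ) < m := by exact_mod_cast hpos
    have h3 : -m < 0 := by omega
    exact_mod_cast h3
  rw [meromorphicOrderAt_congr hFe,
    meromorphicOrderAt_add_eq_left_of_lt hRa.meromorphicAt
      (h1.trans_le hRa.meromorphicOrderAt_nonneg)]
  exact h1

/-! ### From formal power series to functions -/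

def PSRep (f : PowerSeries ℚ) (F : ℂ → ℂ) : Prop :=
  ∀ t : ℂ, ‖t‖ < 1/3 → HasSum (fun n => ((PowerSeries.coeff n f : ℚ) : ℂ) * t ^ n) (F t)

lemma PSRep.add {f g : PowerSeries ℚ} {F G : ℂ → ℂ} (hf : PSRep f F) (hg : PSRep g G) :
    PSRep (f + g) (fun t => F t + G t) := by
  intro t ht
  have := (hf t ht).add (hg t ht)
  simpa [add_mul] using this

lemma PSRep.zero : PSRep 0 (fun _ => 0) := by
  intro t _
  simpa using hasSum_zero

lemma PSRep.sum (r : ℕ) (f : ℕ → PowerSeries ℚ) (F : ℕ → ℂ → ℂ) (h : ∀ i, PSRep (f i) (F i)) :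
    PSRep (∑ i ∈ Finset.range r, f i) (fun t => ∑ i ∈ Finset.range r, F i t) := by
  induction r with
  | zero => simpa using PSRep.zero
  | succ r ih =>
    simp only [Finset.sum_range_succ]
    exact ih.add (h r)

lemma PSRep.poly (p : Polynomial ℚ) : PSRep (p : PowerSeries ℚ) (fun t => Polynomial.aeval t p) := by
  intro t _
  simp only [Polynomial.coeff_coe, Polynomial.aeval_eq_sum_range, Algebra.smul_def]
  refine hasSum_sum_of_ne_finset_zero ?_
  intro n hn
  rw [Polynomial.coeff_eq_zero_of_natDegree_lt (by simpa using hn)]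
  simp

lemma PSRep.mul {f g : PowerSeries ℚ} {F G : ℂ → ℂ} (hf : PSRep f F) (hg : PSRep g G) :
    PSRep (f * g) (fun t => F t * G t) := by
  intro t ht
  have h1 := hf t ht
  have h2 := hg t ht
  have n1 := h1.summable.norm
  have n2 := h2.summable.norm
  have hs := (summable_norm_sum_mul_antidiagonal_of_summable_norm n1 n2).of_norm
  have he := tsum_mul_tsum_eq_tsum_sum_antidiagonal_of_summable_norm n1 n2
  rw [h1.tsum_eq, h2.tsum_eq] at he
  have := hs.hasSum
  rw [← he] at this
  have hfun : (fun n => ((PowerSeries.coeff n (f * g) : ℚ) : ℂ) * t ^ n) = fun n =>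
      ∑ kl ∈ Finset.HasAntidiagonal.antidiagonal n, ((PowerSeries.coeff kl.1 f : ℚ) : ℂ) * t ^ kl.1 *
        (((PowerSeries.coeff kl.2 g : ℚ) : ℂ) * t ^ kl.2) := by
    funext n
    rw [PowerSeries.coeff_mul]
    push_cast
    rw [Finset.sum_mul]
    refine Finset.sum_congr rfl (fun x hx => ?_)
    rw [← Finset.HasAntidiagonal.mem_antidiagonal.mp hx, pow_add]
    ring
  rw [hfun]
  exact this

lemma PSRep.deriv {f : PowerSeries ℚ} {F : ℂ → ℂ} (hf : PSRep f F) :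
    PSRep f.derivativeFun (deriv F) ∧ ∀ t : ℂ, ‖t‖ < 1/3 → DifferentiableAt ℂ F t := by
  have key : ∀ t : ℂ, ‖t‖ < 1/3 →
      HasSum (fun n => ((PowerSeries.coeff n f.derivativeFun : ℚ) : ℂ) * t ^ n) (_root_.deriv F t) ∧
      DifferentiableAt ℂ F t := by
    intro t ht
    obtain ⟨ρ, h1, h2⟩ := exists_between ht
    have hρ : 0 ≤ ρ := (norm_nonneg t).trans h1.le
    have hρn : ‖(ρ : ℂ)‖ = ρ := by simp [abs_of_nonneg hρ]
    set Fn : ℕ → ℂ → ℂ := fun n w => ((PowerSeries.coeff n f : ℚ) : ℂ) * w ^ n with hFn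
    have hu : Summable (fun n => ‖Fn n ρ‖) := (hf ρ (by rw [hρn]; exact h2)).summable.norm
    have htU : t ∈ Metric.ball (0:ℂ) ρ := by simpa using h1
    have hd : ∀ n, DifferentiableOn ℂ (Fn n) (Metric.ball 0 ρ) := by
      intro n
      simp only [hFn]
      fun_prop
    have hle : ∀ n w, w ∈ Metric.ball (0:ℂ) ρ → ‖Fn n w‖ ≤ ‖Fn n ρ‖ := by
      intro n w hw
      have : ‖w‖ ≤ ρ := by simpa using (Metric.mem_ball.mp hw).le
      simp only [hFn]
      rw [norm_mul, norm_mul, norm_pow, norm_pow, hρn]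
      gcongr
    have hS := Complex.hasSum_deriv_of_summable_norm hu hd Metric.isOpen_ball hle htU
    have hD := Complex.differentiableOn_tsum_of_summable_norm hu hd Metric.isOpen_ball hle
    have hFe : (fun w => ∑' n, Fn n w) =ᶠ[nhds t] F := by
      filter_upwards [Metric.isOpen_ball.mem_nhds htU] with w hw
      have : ‖w‖ < ρ := by simpa using (Metric.mem_ball.mp hw)
      exact (hf w (by linarith)).tsum_eq
    refine ⟨?_, (hD.differentiableAt (Metric.isOpen_ball.mem_nhds htU)).congr_of_eventuallyEq
      hFe.symm⟩
    rw [hFe.deriv_eq] at hS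
    have h3 := (hasSum_nat_add_iff' 1).mpr hS
    have hder : ∀ n, _root_.deriv (Fn n) t = ((PowerSeries.coeff n f : ℚ) : ℂ) * (n * t ^ (n-1)) := by
      intro n
      simp only [hFn]
      rw [deriv_const_mul_field]
      simp
    simp only [hder, Finset.range_one, Finset.sum_singleton, Nat.cast_zero, zero_mul, mul_zero,
      sub_zero] at h3
    have hfun : (fun n => ((PowerSeries.coeff n f.derivativeFun : ℚ) : ℂ) * t ^ n) = fun n =>
        ((PowerSeries.coeff (n + 1) f : ℚ) : ℂ) * (((n + 1 : ℕ) : ℂ) * t ^ (n + 1 - 1)) := by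
      funext n
      have hc : PowerSeries.coeff n f.derivativeFun = PowerSeries.coeff (n + 1) f * (n + 1) :=
        PowerSeries.coeff_derivative f n
      rw [hc]
      push_cast
      ring
    rw [hfun]
    exact h3
  exact ⟨fun t ht => (key t ht).1, fun t ht => (key t ht).2⟩

lemma PSRep.iter {f : PowerSeries ℚ} {F : ℂ → ℂ} (hf : PSRep f F) (i : ℕ) :
    PSRep (PowerSeries.derivativeFun^[i] f) (_root_.deriv^[i] F) := by
  induction i with
  | zero => exact hf
  | succ i ih =>
    rw [Function.iterate_succ_apply', Function.iterate_succ_apply']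
    exact ih.deriv.1

lemma PSRep_walk : PSRep (walkGF ({(-1,1),(1,1),(1,-1)} : Finset (ℤ × ℤ))) qwA := by
  intro t ht
  have := (qwA_summable t ht).hasSum
  simp only [← qw_count] at this
  simpa [walkGF, qwA, ← qw_count] using this

lemma ode_of_formal (r : ℕ) (p : ℕ → Polynomial ℚ)
    (h : ∑ i ∈ Finset.range (r + 1), (p i : PowerSeries ℚ) *
          (PowerSeries.derivativeFun^[i] (walkGF ({(-1,1),(1,1),(1,-1)} : Finset (ℤ × ℤ)))) = 0)
    (t : ℂ) (ht : ‖t‖ < 1/3) :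
    ∑ i ∈ Finset.range (r + 1), Polynomial.aeval t (p i) * (deriv^[i] qwA t) = 0 := by
  have h1 := PSRep.sum (r+1) _ _ (fun i => (PSRep.poly (p i)).mul (PSRep_walk.iter i))
  rw [h] at h1
  exact (h1 t ht).unique (PSRep.zero t ht)

/-! ### The domain -/

noncomputable def quc : ℝ := -(Real.log 2) / 2

def quW : Set ℂ := Complex.exp '' ((({w : ℂ | w.re < quc}) ∪ {(quc : ℂ)}) ∪
  (({w : ℂ | quc < w.re}) ∪ {(quc : ℂ)}))

lemma quW_preconnected : IsPreconnected quW := by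
  refine IsPreconnected.image ?_ _ Complex.continuous_exp.continuousOn
  refine IsPreconnected.union (quc : ℂ) (by simp) (by simp) ?_ ?_
  · refine IsPreconnected.subset_closure (convex_halfSpace_re_lt quc).isPreconnected
      Set.subset_union_left ?_
    rw [Complex.closure_setOfPred_re_lt]
    rintro w (hw | hw)
    · simp only [Set.mem_ofPred_eq] at hw ⊢
      exact hw.le
    · rw [Set.mem_singleton_iff] at hw
      simp [hw]
  · refine IsPreconnected.subset_closure (convex_halfSpace_re_gt quc).isPreconnected
      Set.subset_union_left ?_
    rw [Complex.closure_setOfPred_lt_re]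
    rintro w (hw | hw)
    · simp only [Set.mem_ofPred_eq] at hw ⊢
      exact hw.le
    · rw [Set.mem_singleton_iff] at hw
      simp [hw]

lemma normSq_exp_eq (w : ℂ) : Complex.normSq (Complex.exp w) = 1/2 ↔ w.re = quc := by
  rw [Complex.normSq_eq_norm_sq, Complex.norm_exp, ← Real.exp_nat_mul]
  have : (1/2 : ℝ) = Real.exp (2 * quc) := by
    rw [quc, show 2 * (-Real.log 2 / 2) = - Real.log 2 by ring, Real.exp_neg,
      Real.exp_log (by norm_num)]
    norm_num
  rw [this, Real.exp_eq_exp]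
  push_cast
  constructor <;> intro h <;> linarith

lemma quW_good (z : ℂ) (hz : z ∈ quW) : quGood z := by
  obtain ⟨w, hw, rfl⟩ := hz
  apply quGood_of' _ (Complex.exp_ne_zero w)
  by_cases h : w.re = quc
  · right
    have : w = (quc : ℂ) := by
      rcases hw with (hw | hw) | (hw | hw)
      · exact absurd h (ne_of_lt hw)
      · exact hw
      · exact absurd h (ne_of_gt hw)
      · exact hw
    rw [this, ← Complex.ofReal_exp]
    exact Complex.ofReal_im _
  · left
    rwa [Ne, normSq_exp_eq]

lemma mem_quW (z : ℂ) (hz : z ≠ 0) (h : Complex.normSq z ≠ 1/2) : z ∈ quW := by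
  refine ⟨Complex.log z, ?_, Complex.exp_log hz⟩
  have h1 : (Complex.log z).re ≠ quc := by
    rw [Ne, ← normSq_exp_eq, Complex.exp_log hz]
    exact h
  rcases lt_or_gt_of_ne h1 with h2 | h2
  · exact Or.inl (Or.inl h2)
  · exact Or.inr (Or.inl h2)

/-! ### The differential operator -/

noncomputable def quT' (z : ℂ) : ℂ := (1 - 2 * z ^ 2) / (1 + 2 * z ^ 2) ^ 2

lemma qut_hasDerivAt (z : ℂ) (h : 1 + 2 * z ^ 2 ≠ 0) : HasDerivAt qut (quT' z) z := by
  have h1 : HasDerivAt (fun w : ℂ => 1 + 2 * w ^ 2) (2 * (2 * z)) z := by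
    have := ((hasDerivAt_pow 2 z).const_mul 2).const_add 1
    simpa using this
  have h2 := (hasDerivAt_id z).div h1 h
  have e : quT' z = (1 * (1 + 2 * z ^ 2) - id z * (2 * (2 * z))) / (1 + 2 * z ^ 2) ^ 2 := by
    unfold quT'
    simp only [id]
    ring
  rw [e]
  exact h2

noncomputable def quD (g : ℂ → ℂ) : ℂ → ℂ := fun z => (quT' z)⁻¹ * deriv g z

noncomputable def quG (z : ℂ) : ℂ := (1 - 2 * quF z) * (1 - 3 * qut z)⁻¹

lemma quG_small (z : ℂ) (hz : z ≠ 0) (h : ‖z‖ < 1/10) : quG z = qwA (qut z) := by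
  have h1 : 1 - 3 * qut z ≠ 0 := by
    intro h0
    have h2 := qut_small z h
    have : qut z = 1/3 := by linear_combination (-1/3) * h0
    rw [this] at h2
    norm_num at h2
  rw [quG, ← quF_A z hz h]
  field_simp

lemma one_sub_ne (z : ℂ) (h : ‖z‖ < 1/10) : 1 - 2 * z ^ 2 ≠ 0 := by
  have := one_add_ne (z * Complex.I) (by simpa using h)
  rw [mul_pow, Complex.I_sq] at this
  intro h0
  apply this
  linear_combination h0

lemma quD_small (i : ℕ) : ∀ z : ℂ, z ≠ 0 → ‖z‖ < 1/10 →
    quD^[i] quG z = deriv^[i] qwA (qut z) := by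
  induction i with
  | zero => exact quG_small
  | succ i ih =>
    intro z hz h
    rw [Function.iterate_succ_apply', Function.iterate_succ_apply', quD]
    have hd := one_add_ne z h
    have he : quD^[i] quG =ᶠ[nhds z] (deriv^[i] qwA) ∘ qut := by
      have o1 : ∀ᶠ w in nhds z, w ≠ 0 := isOpen_ne.mem_nhds hz
      have o2 : ∀ᶠ w in nhds z, ‖w‖ < 1/10 := continuous_norm.continuousAt.eventually_lt
        continuousAt_const h
      filter_upwards [o1, o2] with w h1 h2
      exact ih w h1 h2
    have hq := qut_hasDerivAt z hd
    have hA := ((PSRep_walk.iter i).deriv.2 (qut z) (qut_small z h)).hasDerivAt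
    rw [he.deriv_eq, (hA.comp z hq).deriv]
    have : quT' z ≠ 0 := div_ne_zero (one_sub_ne z h) (pow_ne_zero _ hd)
    field_simp

lemma qut_meromorphicAt (z : ℂ) : MeromorphicAt qut z := by
  unfold qut
  fun_prop

lemma quT'_meromorphicAt (z : ℂ) : MeromorphicAt quT' z := by
  unfold quT'
  fun_prop

lemma quG_meromorphicAt (z : ℂ) (h : quGood z) : MeromorphicAt quG z := by
  have h1 := quF_meromorphicAt z h
  have h2 := qut_meromorphicAt z
  unfold quG
  fun_prop

lemma quD_meromorphicAt (z : ℂ) (h : quGood z) (i : ℕ) : MeromorphicAt (quD^[i] quG) z := by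
  induction i with
  | zero => exact quG_meromorphicAt z h
  | succ i ih =>
    rw [Function.iterate_succ_apply']
    exact (quT'_meromorphicAt z).inv.mul ih.deriv

lemma aeval_qut_meromorphicAt (p : Polynomial ℚ) (z : ℂ) :
    MeromorphicAt (fun w => Polynomial.aeval (qut w) p) z := by
  have h2 := qut_meromorphicAt z
  simp only [Polynomial.aeval_eq_sum_range, Algebra.smul_def]
  fun_prop

lemma one_add_ne' (z : ℂ) (hz : z ≠ 0) (h : quv z ≠ 0) : 1 + 2 * z ^ 2 ≠ 0 := by
  intro h0
  apply h
  rw [quv]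
  field_simp
  linear_combination h0

lemma qut_analyticAt (z : ℂ) (h : 1 + 2 * z ^ 2 ≠ 0) : AnalyticAt ℂ qut z := by
  unfold qut
  fun_prop (disch := assumption)

lemma quT'_analyticAt (z : ℂ) (h : 1 + 2 * z ^ 2 ≠ 0) : AnalyticAt ℂ quT' z := by
  unfold quT'
  have := pow_ne_zero 2 h
  fun_prop (disch := assumption)

lemma aeval_qut_analyticAt (p : Polynomial ℚ) (z : ℂ) (h : 1 + 2 * z ^ 2 ≠ 0) :
    AnalyticAt ℂ (fun w => Polynomial.aeval (qut w) p) z := by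
  have h2 := qut_analyticAt z h
  simp only [Polynomial.aeval_eq_sum_range, Algebra.smul_def]
  fun_prop

/-- Facts at a zero of `qu`. -/
lemma zero_facts (z : ℂ) (hz : z ≠ 0) (k : ℕ) (hk : qu z (k+1) = 0) :
    z ∈ quW ∧ 1 + 2 * z ^ 2 ≠ 0 ∧ quT' z ≠ 0 ∧ 1 - 3 * qut z ≠ 0 := by
  have hn := qu_zero_normSq z hz _ hk
  have hr := qu_zero_nonreal z hz _ hk
  have h1 : 1 + 2 * z ^ 2 ≠ 0 := one_add_ne' z hz (by simpa using hr 0)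
  refine ⟨mem_quW z hz hn, h1, ?_, ?_⟩
  · refine div_ne_zero ?_ (pow_ne_zero _ h1)
    intro h0
    apply hn
    have h2 : z ^ 2 = 1/2 := by linear_combination (-1/2) * h0
    have h3 := congrArg norm h2
    rw [norm_pow] at h3
    rw [Complex.normSq_eq_norm_sq, h3]
    norm_num
  · intro h0
    apply hr 3
    have h5 : qut z = 1/3 := by linear_combination (-1/3) * h0
    rw [qut, div_eq_iff h1] at h5
    rw [quv]
    push_cast
    field_simp
    linear_combination (-3) * h5

lemma quD_order (z : ℂ) (hz : z ≠ 0) (k : ℕ) (hk : qu z (k+1) = 0) :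
    ∃ e : ℤ, ∀ i : ℕ, meromorphicOrderAt (quD^[i] quG) z = ((e - i : ℤ) : WithTop ℤ) := by
  obtain ⟨hW, h1, h2, h3⟩ := zero_facts z hz k hk
  have hg := quW_good z hW
  have hF := quF_order z hg k hk
  have hG : meromorphicOrderAt quG z < 0 := by
    have a1 : AnalyticAt ℂ (fun w => (1 - 3 * qut w)⁻¹) z := by
      have := qut_analyticAt z h1
      fun_prop (disch := assumption)
    have a2 : AnalyticAt ℂ (fun w : ℂ => (1:ℂ)) z := analyticAt_const
    have a3 : AnalyticAt ℂ (fun w : ℂ => (-2:ℂ)) z := analyticAt_const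
    have e : quG = (fun w => (1 - 3 * qut w)⁻¹) * ((fun w => (-2:ℂ)) * quF + fun w => (1:ℂ)) := by
      funext w
      simp only [quG, Pi.mul_apply, Pi.add_apply]
      ring
    have o1 : meromorphicOrderAt ((fun w => (-2:ℂ)) * quF) z = meromorphicOrderAt quF z :=
      meromorphicOrderAt_mul_of_ne_zero a3 (by norm_num)
    rw [e, meromorphicOrderAt_mul_of_ne_zero a1 (inv_ne_zero h3),
      meromorphicOrderAt_add_eq_left_of_lt a2.meromorphicAt, o1]
    · exact hF
    · rw [o1]
      exact hF.trans_le a2.meromorphicOrderAt_nonneg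
  obtain ⟨e, he⟩ := WithTop.ne_top_iff_exists.mp (ne_top_of_lt hG)
  have he0 : e < 0 := by rw [← he] at hG; exact_mod_cast hG
  refine ⟨e, fun i => ?_⟩
  induction i with
  | zero => simp [he]
  | succ i ih =>
    rw [Function.iterate_succ_apply']
    have hd := meromorphicOrderAt_deriv_eq_sub_one (n := e - i) (by
      have : e - i ≠ 0 := by omega
      exact_mod_cast this) ih
    have : quD (quD^[i] quG) = quT'⁻¹ * deriv (quD^[i] quG) := rfl
    rw [this, meromorphicOrderAt_mul_of_ne_zero ((quT'_analyticAt z h1).inv h2) (inv_ne_zero h2), hd]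
    congr 1
    push_cast
    ring

lemma exists_good_zero (p : Polynomial ℚ) (hp : p ≠ 0) :
    ∃ (z : ℂ) (k : ℕ), z ≠ 0 ∧ qu z (k+1) = 0 ∧ Polynomial.aeval (qut z) p ≠ 0 := by
  by_contra hcon
  push Not at hcon
  choose zz hz0 hzz using qu_exists_zero
  have hinj : Function.Injective zz := by
    intro m n hmn
    obtain ⟨_, l, hl, hv⟩ := quW_good _ (zero_facts (zz m) (hz0 m) (m+1) (hzz m)).1
    have := qu_zero_unique (hz0 m) hl hv (hzz m) (by rw [hmn]; exact hzz n)
    omega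
  have hfin : Set.Finite {z : ℂ | 1 + 2 * z ^ 2 ≠ 0 ∧ Polynomial.aeval (qut z) p = 0} := by
    have hq : p.map (algebraMap ℚ ℂ) ≠ 0 := by
      rwa [Polynomial.map_ne_zero_iff (algebraMap ℚ ℂ).injective]
    have hb : Set.Finite (⋃ ρ ∈ (p.map (algebraMap ℚ ℂ)).roots.toFinset,
        ((Polynomial.C (2 * ρ) * Polynomial.X ^ 2 - Polynomial.X + Polynomial.C ρ).roots.toFinset :
          Set ℂ)) :=
      Set.Finite.biUnion (Finset.finite_toSet _) (fun ρ _ => Finset.finite_toSet _)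
    refine hb.subset ?_
    rintro z ⟨h1, h2⟩
    simp only [Set.mem_iUnion]
    refine ⟨qut z, ?_, ?_⟩
    · simp only [Multiset.mem_toFinset, Polynomial.mem_roots hq, Polynomial.IsRoot,
        Polynomial.eval_map_algebraMap]
      exact h2
    · have hne : (Polynomial.C (2 * qut z) * Polynomial.X ^ 2 - Polynomial.X
          + Polynomial.C (qut z)) ≠ 0 := by
        intro h0
        have := congrArg (fun q => Polynomial.coeff q 1) h0
        simp only [Polynomial.coeff_add, Polynomial.coeff_sub, Polynomial.coeff_C_mul,
          Polynomial.coeff_X_pow, Polynomial.coeff_X_one, Polynomial.coeff_C,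
          Polynomial.coeff_zero] at this
        norm_num at this
      simp only [Finset.mem_coe, Multiset.mem_toFinset, Polynomial.mem_roots hne,
        Polynomial.IsRoot]
      simp only [Polynomial.eval_add, Polynomial.eval_sub, Polynomial.eval_mul, Polynomial.eval_C,
        Polynomial.eval_pow, Polynomial.eval_X, qut]
      field_simp
      ring
  refine Set.infinite_of_injective_forall_mem hinj (s := {z : ℂ | 1 + 2 * z ^ 2 ≠ 0 ∧
    Polynomial.aeval (qut z) p = 0}) ?_ hfin
  intro m
  exact ⟨(zero_facts (zz m) (hz0 m) (m+1) (hzz m)).2.1, hcon (zz m) (m+1) (hz0 m) (hzz m)⟩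

lemma not_ode (r : ℕ) (p : ℕ → Polynomial ℚ) (hp : p r ≠ 0)
    (h : ∑ i ∈ Finset.range (r + 1), (p i : PowerSeries ℚ) *
          (PowerSeries.derivativeFun^[i] (walkGF ({(-1,1),(1,1),(1,-1)} : Finset (ℤ × ℤ)))) = 0) :
    False := by
  obtain ⟨z, k, hz, hk, hpz⟩ := exists_good_zero (p r) hp
  obtain ⟨hW, h1, h2, h3⟩ := zero_facts z hz k hk
  obtain ⟨e, he⟩ := quD_order z hz k hk
  set term : ℕ → ℂ → ℂ := fun i => (fun w => Polynomial.aeval (qut w) (p i)) * (quD^[i] quG)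
    with hterm
  have hmt : ∀ i w, quGood w → MeromorphicAt (term i) w := fun i w hw =>
    (aeval_qut_meromorphicAt (p i) w).mul (quD_meromorphicAt w hw i)
  set S : ℕ → ℂ → ℂ := fun n => ∑ i ∈ Finset.range n, term i with hS
  have hmS : ∀ n w, quGood w → MeromorphicAt (S n) w := fun n w hw =>
    MeromorphicAt.sum (fun i _ => hmt i w hw)
  have hSs : ∀ n, S (n+1) = S n + term n := fun n => by
    simp only [hS, Finset.sum_range_succ]
  have hg := quW_good z hW
  have hbound : ∀ n : ℕ, ((e - n + 1 : ℤ) : WithTop ℤ) ≤ meromorphicOrderAt (S n) z := by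
    intro n
    induction n with
    | zero =>
      have : meromorphicOrderAt (S 0) z = ⊤ := by
        rw [meromorphicOrderAt_eq_top_iff]
        simp [hS]
      rw [this]
      exact le_top
    | succ n ih =>
      rw [hSs]
      refine le_trans ?_ (meromorphicOrderAt_add (hmS n z hg) (hmt n z hg))
      refine le_min ?_ ?_
      · refine le_trans ?_ ih
        have : e - ((n+1 : ℕ) : ℤ) + 1 ≤ e - n + 1 := by push_cast; omega
        exact_mod_cast this
      · rw [hterm, meromorphicOrderAt_mul (aeval_qut_meromorphicAt (p n) z)
          (quD_meromorphicAt z hg n), he n]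
        have h0 := (aeval_qut_analyticAt (p n) z h1).meromorphicOrderAt_nonneg
        have : e - ((n+1 : ℕ) : ℤ) + 1 = e - n := by push_cast; ring
        rw [this]
        exact le_add_of_nonneg_left h0
  have hlast : meromorphicOrderAt (term r) z = ((e - r : ℤ) : WithTop ℤ) := by
    rw [← he r]
    exact meromorphicOrderAt_mul_of_ne_zero (aeval_qut_analyticAt (p r) z h1) hpz
  have hlt : meromorphicOrderAt (term r) z < meromorphicOrderAt (S r) z := by
    rw [hlast]
    refine lt_of_lt_of_le ?_ (hbound r)
    have : e - r < e - r + 1 := by omega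
    exact_mod_cast this
  have hord : meromorphicOrderAt (S (r+1)) z ≠ ⊤ := by
    rw [hSs, add_comm, meromorphicOrderAt_add_eq_left_of_lt (hmS r z hg) hlt, hlast]
    exact WithTop.coe_ne_top
  -- a point near zero
  set z₁ : ℂ := 1/20 with hz₁
  have hz1n : ‖z₁‖ = 1/20 := by rw [hz₁]; norm_num
  have hz1W : z₁ ∈ quW := by
    apply mem_quW
    · rw [hz₁]; norm_num
    · rw [Complex.normSq_eq_norm_sq, hz1n]; norm_num
  have hne := MeromorphicOn.meromorphicOrderAt_ne_top_of_isPreconnected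
    (f := S (r+1)) (U := quW) (fun w hw => hmS (r+1) w (quW_good w hw)) quW_preconnected hW hz1W hord
  apply hne
  rw [meromorphicOrderAt_eq_top_iff]
  apply Filter.Eventually.filter_mono nhdsWithin_le_nhds
  have o1 : ∀ᶠ w in nhds z₁, w ≠ 0 := isOpen_ne.mem_nhds (by rw [hz₁]; norm_num)
  have o2 : ∀ᶠ w in nhds z₁, ‖w‖ < 1/10 := continuous_norm.continuousAt.eventually_lt
    continuousAt_const (by rw [hz1n]; norm_num)
  filter_upwards [o1, o2] with w hw0 hw1
  have := ode_of_formal r p h (qut w) (qut_small w hw1)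
  rw [← this]
  simp only [hS, hterm, Finset.sum_apply, Pi.mul_apply]
  refine Finset.sum_congr rfl (fun i _ => ?_)
  rw [quD_small i w hw0 hw1]

theorem modelA_not_DFinite :
    ¬ ∃ (r : ℕ) (p : ℕ → Polynomial ℚ),
      (∃ i, i ≤ r ∧ p i ≠ 0) ∧
      ∑ i ∈ Finset.range (r + 1),
        (p i : PowerSeries ℚ) *
          (PowerSeries.derivativeFun^[i] (walkGF ({(-1,1),(1,1),(1,-1)} : Finset (ℤ × ℤ)))) = 0 := by
  rintro ⟨r, p, ⟨i, hi, hpi⟩, h⟩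
  induction r with
  | zero =>
    obtain rfl : i = 0 := by omega
    exact not_ode 0 p hpi h
  | succ r ih =>
    by_cases hr : p (r+1) = 0
    · have hir : i ≠ r + 1 := by rintro rfl; exact hpi hr
      have h' := h
      rw [Finset.sum_range_succ, hr] at h'
      exact ih (by simpa using h') (by omega)
    · exact not_ode (r+1) p hr h
end
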